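/- arXiv:2407.05460 — 3 statements merged into one kernel-verified Lean document; each statement's English description precedes it below -/
import Mathlib

section
/- Let Ψ_K be a uniformly random bijection from [K]×[K] to {1,…,K²} and let W_K be its number of pure Nash equilibria. Then for every δ > 0, lim_{K→∞} P(|W_K/K − 1/2| < δ) = 1; i.e., W_K/K converges in probability to 1/2. -/
open scoped Classical

noncomputable section

/-- `p` is a pure Nash equilibrium of the potential `Ψ`: a strict minimum of `Ψ`
in its row and in its column. -/
def IsPNE {K : ℕ} (Ψ : Fin K × Fin K → ℝ) (p : Fin K × Fin K) : Prop :=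
  (∀ a' : Fin K, a' ≠ p.1 → Ψ p < Ψ (a', p.2)) ∧
  (∀ b' : Fin K, b' ≠ p.2 → Ψ p < Ψ (p.1, b'))

/-- Real-valued potential associated with a bijection into `Fin (K^2)`,
taking values in `{1, …, K²}`. -/
def pot {K : ℕ} (Ψ : (Fin K × Fin K) ≃ Fin (K ^ 2)) (p : Fin K × Fin K) : ℝ :=
  (Ψ p : ℕ) + 1


/-- If the event `E` is stable under transposing two cells of `S`, then each cell of `S` is equally
likely to be the argmin of `Ψ` on `S` given `E`. -/
lemma card_filter_and_isMinOn_mul_card {α : Type*} [Fintype α] [DecidableEq α] {n : ℕ}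
    (E : (α ≃ Fin n) → Prop) (S : Finset α) {q : α} (hq : q ∈ S)
    (hE : ∀ q' ∈ S, ∀ Ψ, E Ψ → E ((Equiv.swap q q').trans Ψ)) :
    (Finset.univ.filter fun Ψ : α ≃ Fin n => E Ψ ∧ IsMinOn Ψ (S : Set α) q).card * S.card =
      (Finset.univ.filter fun Ψ : α ≃ Fin n => E Ψ).card := by
  have hswap : ∀ q' ∈ S, ∀ x ∈ S, Equiv.swap q q' x ∈ S := by
    intro q' hq' x hx
    rw [Equiv.swap_apply_def]
    split_ifs <;> assumption
  have hinv : ∀ q' (Ψ : α ≃ Fin n),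
      (Equiv.swap q q').trans ((Equiv.swap q q').trans Ψ) = Ψ := by
    intro q' Ψ
    ext x
    simp
  have hcard : ∀ q' ∈ S,
      (Finset.univ.filter fun Ψ : α ≃ Fin n => E Ψ ∧ IsMinOn Ψ (S : Set α) q').card =
        (Finset.univ.filter fun Ψ : α ≃ Fin n => E Ψ ∧ IsMinOn Ψ (S : Set α) q).card := by
    intro q' hq'
    refine Finset.card_nbij' (fun Ψ => (Equiv.swap q q').trans Ψ)
      (fun Ψ => (Equiv.swap q q').trans Ψ) ?_ ?_ (fun Ψ _ => hinv q' Ψ) (fun Ψ _ => hinv q' Ψ)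
    all_goals
      intro Ψ hΨ
      simp only [Finset.coe_filter, Finset.mem_univ, true_and, Set.mem_ofPred_eq,
        isMinOn_iff, Finset.mem_coe] at hΨ ⊢
      refine ⟨hE q' hq' Ψ hΨ.1, fun x hx => ?_⟩
      simpa using hΨ.2 _ (hswap q' hq' x hx)
  calc _ = ∑ q' ∈ S,
        (Finset.univ.filter fun Ψ : α ≃ Fin n => E Ψ ∧ IsMinOn Ψ (S : Set α) q').card := by
        rw [Finset.sum_congr rfl hcard, Finset.sum_const, smul_eq_mul, mul_comm]
    _ = ∑ Ψ ∈ Finset.univ.filter (fun Ψ : α ≃ Fin n => E Ψ),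
        (S.filter fun q' => IsMinOn Ψ (S : Set α) q').card := by
        simp_rw [← Finset.filter_filter, Finset.card_filter _ (Finset.filter _ _)]
        rw [Finset.sum_comm]
        simp_rw [Finset.card_filter]
    _ = _ := by
        rw [Finset.card_eq_sum_ones]
        refine Finset.sum_congr rfl fun Ψ _ => ?_
        obtain ⟨m, hm, hmin⟩ := S.exists_min_image Ψ ⟨q, hq⟩
        rw [Finset.card_eq_one]
        refine ⟨m, ?_⟩
        ext x
        simp only [Finset.mem_filter, Finset.mem_singleton, isMinOn_iff, Finset.mem_coe]
        constructor
        · rintro ⟨hx, h⟩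
          exact Ψ.injective (le_antisymm (h m hm) (hmin x hx))
        · rintro rfl
          exact ⟨hm, hmin⟩

lemma card_filter_isMinOn_mul_card {α : Type*} [Fintype α] [DecidableEq α] {n : ℕ}
    (S : Finset α) {q : α} (hq : q ∈ S) :
    (Finset.univ.filter fun Ψ : α ≃ Fin n => IsMinOn Ψ (S : Set α) q).card * S.card =
      Fintype.card (α ≃ Fin n) := by
  simpa using card_filter_and_isMinOn_mul_card (n := n) (fun _ => True) S hq (by simp)

lemma card_filter_isMinOn_and_isMinOn_mul {α : Type*} [Fintype α] [DecidableEq α] {n : ℕ}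
    {S T : Finset α} (hST : S ⊆ T) {p q : α} (hpT : p ∈ T) (hpS : p ∉ S) (hq : q ∈ S) :
    (Finset.univ.filter fun Ψ : α ≃ Fin n =>
        IsMinOn Ψ (T : Set α) p ∧ IsMinOn Ψ (S : Set α) q).card * S.card * T.card =
      Fintype.card (α ≃ Fin n) := by
  rw [card_filter_and_isMinOn_mul_card (n := n) (fun Ψ => IsMinOn Ψ (T : Set α) p) S hq,
    card_filter_isMinOn_mul_card T hpT]
  intro q' hq' Ψ h
  rw [isMinOn_iff] at h ⊢
  intro x hx
  have hp : Equiv.swap q q' p = p :=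
    Equiv.swap_apply_of_ne_of_ne (fun h => hpS (h ▸ hq)) (fun h => hpS (h ▸ hq'))
  rw [Equiv.trans_apply, Equiv.trans_apply, hp]
  refine h _ ?_
  rw [Finset.mem_coe, Equiv.swap_apply_def]
  split_ifs
  exacts [hST hq', hST hq, hx]

/-- The union of the row and the column through `p`. -/
def cross {K : ℕ} (p : Fin K × Fin K) : Finset (Fin K × Fin K) :=
  ({p.1} ×ˢ Finset.univ) ∪ (Finset.univ ×ˢ {p.2})

lemma mem_cross {K : ℕ} {p x : Fin K × Fin K} : x ∈ cross p ↔ x.1 = p.1 ∨ x.2 = p.2 := by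
  rcases x with ⟨a, b⟩
  simp [cross, eq_comm]

lemma self_mem_cross {K : ℕ} (p : Fin K × Fin K) : p ∈ cross p := mem_cross.2 (Or.inl rfl)

lemma card_cross {K : ℕ} (p : Fin K × Fin K) : (cross p).card + 1 = 2 * K := by
  have h := Finset.card_union_add_card_inter (({p.1} : Finset (Fin K)) ×ˢ Finset.univ)
    ((Finset.univ : Finset (Fin K)) ×ˢ {p.2})
  have hi : (({p.1} : Finset (Fin K)) ×ˢ Finset.univ) ∩ ((Finset.univ : Finset (Fin K)) ×ˢ {p.2})
      = {p} := by
    ext x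
    simp [Prod.ext_iff, eq_comm]
  rw [hi] at h
  simp only [Finset.card_product, Finset.card_singleton, Finset.card_univ, Fintype.card_fin] at h
  unfold cross
  omega

lemma card_cross_union {K : ℕ} {p q : Fin K × Fin K} (hq : q ∉ cross p) :
    (cross p ∪ cross q).card + 4 = 4 * K := by
  have h := Finset.card_union_add_card_inter (cross p) (cross q)
  rw [mem_cross, not_or] at hq
  have hi : cross p ∩ cross q = {(p.1, q.2), (q.1, p.2)} := by
    ext x
    simp only [Finset.mem_inter, mem_cross, Finset.mem_insert, Finset.mem_singleton, Prod.ext_iff]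
    grind
  rw [hi, Finset.card_pair (by simp [Prod.ext_iff, Ne.symm hq.1])] at h
  have := card_cross p
  have := card_cross q
  omega

lemma isPNE_pot_iff {K : ℕ} (Ψ : (Fin K × Fin K) ≃ Fin (K ^ 2)) (p : Fin K × Fin K) :
    IsPNE (pot Ψ) p ↔ IsMinOn Ψ (cross p : Set (Fin K × Fin K)) p := by
  have hlt : ∀ x, pot Ψ p < pot Ψ x ↔ Ψ p < Ψ x := by
    intro x
    simp [pot]
  simp only [IsPNE, hlt, isMinOn_iff, Finset.mem_coe, mem_cross]
  constructor
  · rintro ⟨h1, h2⟩ ⟨a, b⟩ (h | h)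
    · obtain rfl : a = p.1 := h
      by_cases hb : b = p.2
      · rw [hb]
      · exact (h2 b hb).le
    · obtain rfl : b = p.2 := h
      by_cases ha : a = p.1
      · rw [ha]
      · exact (h1 a ha).le
  · intro h
    refine ⟨fun a ha => lt_of_le_of_ne (h _ (Or.inr rfl)) fun he => ha ?_,
      fun b hb => lt_of_le_of_ne (h _ (Or.inl rfl)) fun he => hb ?_⟩
    · exact (congrArg Prod.fst (Ψ.injective he)).symm
    · exact (congrArg Prod.snd (Ψ.injective he)).symm

lemma card_isPNE_mul {K : ℕ} (p : Fin K × Fin K) :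
    ((Finset.univ.filter fun Ψ : (Fin K × Fin K) ≃ Fin (K ^ 2) => IsPNE (pot Ψ) p).card : ℝ) *
      (2 * K - 1) = Fintype.card ((Fin K × Fin K) ≃ Fin (K ^ 2)) := by
  rw [← card_filter_isMinOn_mul_card (cross p) (self_mem_cross p)]
  simp_rw [isPNE_pot_iff]
  have : ((cross p).card : ℝ) + 1 = 2 * K := mod_cast card_cross p
  push_cast
  rw [← this, add_sub_cancel_right]

lemma isPNE_and_isPNE_iff {K : ℕ} (Ψ : (Fin K × Fin K) ≃ Fin (K ^ 2)) (p q : Fin K × Fin K) :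
    IsPNE (pot Ψ) p ∧ IsPNE (pot Ψ) q ↔
      (IsMinOn Ψ ((cross p ∪ cross q : Finset _) : Set (Fin K × Fin K)) p ∧
        IsMinOn Ψ (cross q : Set (Fin K × Fin K)) q) ∨
      (IsMinOn Ψ ((cross p ∪ cross q : Finset _) : Set (Fin K × Fin K)) q ∧
        IsMinOn Ψ (cross p : Set (Fin K × Fin K)) p) := by
  simp only [isPNE_pot_iff, isMinOn_iff, Finset.mem_coe, Finset.mem_union]
  constructor
  · rintro ⟨hp, hq⟩
    rcases le_total (Ψ p) (Ψ q) with h | h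
    · exact Or.inl ⟨fun x hx => hx.elim (hp x) fun hx => h.trans (hq x hx), hq⟩
    · exact Or.inr ⟨fun x hx => hx.elim (fun hx => h.trans (hp x hx)) (hq x), hp⟩
  · rintro (⟨h, hq⟩ | ⟨h, hp⟩)
    · exact ⟨fun x hx => h x (Or.inl hx), hq⟩
    · exact ⟨hp, fun x hx => h x (Or.inr hx)⟩

lemma card_isPNE_and_isPNE_mul {K : ℕ} {p q : Fin K × Fin K} (hq : q ∉ cross p) :
    ((Finset.univ.filter fun Ψ : (Fin K × Fin K) ≃ Fin (K ^ 2) =>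
        IsPNE (pot Ψ) p ∧ IsPNE (pot Ψ) q).card : ℝ) * ((2 * K - 1) * (2 * K - 2)) =
      Fintype.card ((Fin K × Fin K) ≃ Fin (K ^ 2)) := by
  have hp : p ∉ cross q := fun h => hq (mem_cross.2 ((mem_cross.1 h).imp Eq.symm Eq.symm))
  have hpq : p ≠ q := by
    rintro rfl
    exact hq (self_mem_cross p)
  have h1 := card_filter_isMinOn_and_isMinOn_mul (n := K ^ 2)
    (Finset.subset_union_right : cross q ⊆ cross p ∪ cross q)
    (Finset.mem_union_left _ (self_mem_cross p)) hp (self_mem_cross q)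
  have h2 := card_filter_isMinOn_and_isMinOn_mul (n := K ^ 2)
    (Finset.subset_union_left : cross p ⊆ cross p ∪ cross q)
    (Finset.mem_union_right _ (self_mem_cross q)) hq (self_mem_cross p)
  simp_rw [isPNE_and_isPNE_iff]
  rw [Finset.filter_or, Finset.card_union_of_disjoint]
  · have hcp : ((cross p).card : ℝ) = 2 * K - 1 := eq_sub_of_add_eq (mod_cast card_cross p)
    have hcq : ((cross q).card : ℝ) = 2 * K - 1 := eq_sub_of_add_eq (mod_cast card_cross q)
    have hcu : ((cross p ∪ cross q).card : ℝ) = 4 * K - 4 :=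
      eq_sub_of_add_eq (mod_cast card_cross_union hq)
    have h1' := congrArg (Nat.cast : ℕ → ℝ) h1
    have h2' := congrArg (Nat.cast : ℕ → ℝ) h2
    push_cast at h1' h2' ⊢
    rw [hcq, hcu] at h1'
    rw [hcp, hcu] at h2'
    linear_combination (h1' + h2') / 2
  · rw [Finset.disjoint_filter]
    rintro Ψ - ⟨hp', -⟩ ⟨hq', -⟩
    rw [isMinOn_iff] at hp' hq'
    refine hpq (Ψ.injective (le_antisymm (hp' q ?_) (hq' p ?_)))
    · simp [self_mem_cross]
    · simp [self_mem_cross]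

lemma isPNE_unique_of_mem_cross {K : ℕ} {Ψ : (Fin K × Fin K) ≃ Fin (K ^ 2)} {p q : Fin K × Fin K}
    (hq : q ∈ cross p) (h : IsPNE (pot Ψ) p ∧ IsPNE (pot Ψ) q) : q = p := by
  have hp : p ∈ cross q := mem_cross.2 ((mem_cross.1 hq).imp Eq.symm Eq.symm)
  rw [isPNE_pot_iff, isPNE_pot_iff, isMinOn_iff, isMinOn_iff] at h
  exact Ψ.injective (le_antisymm (h.2 p hp) (h.1 q hq))

/-- The number of PNE of `Ψ`. -/
def numPNE {K : ℕ} (Ψ : (Fin K × Fin K) ≃ Fin (K ^ 2)) : ℕ :=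
  (Finset.univ.filter fun p : Fin K × Fin K => IsPNE (pot Ψ) p).card

lemma sum_numPNE {K : ℕ} (hK : 2 ≤ K) :
    ∑ Ψ : (Fin K × Fin K) ≃ Fin (K ^ 2), (numPNE Ψ : ℝ) =
      K ^ 2 / (2 * K - 1) * Fintype.card ((Fin K × Fin K) ≃ Fin (K ^ 2)) := by
  have hK' : (2 : ℝ) ≤ K := mod_cast hK
  have h1 : (2 * K - 1 : ℝ) ≠ 0 := by linarith
  calc _ = ∑ p : Fin K × Fin K, ((Finset.univ.filter
        fun Ψ : (Fin K × Fin K) ≃ Fin (K ^ 2) => IsPNE (pot Ψ) p).card : ℝ) := by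
        simp_rw [numPNE, Finset.card_filter, Nat.cast_sum]
        exact Finset.sum_comm
    _ = ∑ p : Fin K × Fin K,
        (Fintype.card ((Fin K × Fin K) ≃ Fin (K ^ 2)) : ℝ) / (2 * K - 1) :=
        Finset.sum_congr rfl fun p _ => eq_div_of_mul_eq h1 (card_isPNE_mul p)
    _ = _ := by
        simp only [Finset.sum_const, Finset.card_univ, Fintype.card_prod, Fintype.card_fin,
          nsmul_eq_mul, Nat.cast_mul]
        ring

lemma sum_card_isPNE_and_isPNE {K : ℕ} (hK : 2 ≤ K) (p : Fin K × Fin K) :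
    ∑ q : Fin K × Fin K, ((Finset.univ.filter fun Ψ : (Fin K × Fin K) ≃ Fin (K ^ 2) =>
        IsPNE (pot Ψ) p ∧ IsPNE (pot Ψ) q).card : ℝ) =
      (K + 1) / (2 * (2 * K - 1)) * Fintype.card ((Fin K × Fin K) ≃ Fin (K ^ 2)) := by
  have hK' : (2 : ℝ) ≤ K := mod_cast hK
  have h1 : (2 * K - 1 : ℝ) ≠ 0 := by linarith
  have h2 : (2 * K - 2 : ℝ) ≠ 0 := by linarith
  have h3 : (K - 1 : ℝ) ≠ 0 := by linarith
  rw [← Finset.sum_add_sum_compl (cross p)]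
  have hin : ∑ q ∈ cross p, ((Finset.univ.filter fun Ψ : (Fin K × Fin K) ≃ Fin (K ^ 2) =>
        IsPNE (pot Ψ) p ∧ IsPNE (pot Ψ) q).card : ℝ) =
      (Fintype.card ((Fin K × Fin K) ≃ Fin (K ^ 2)) : ℝ) / (2 * K - 1) := by
    rw [Finset.sum_eq_single_of_mem p (self_mem_cross p)]
    · simp_rw [and_self]
      exact eq_div_of_mul_eq h1 (card_isPNE_mul p)
    · intro q hq hne
      rw [Nat.cast_eq_zero, Finset.card_eq_zero, Finset.filter_eq_empty_iff]
      exact fun Ψ _ h => hne (isPNE_unique_of_mem_cross hq h)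
  have hout : ∑ q ∈ (cross p)ᶜ, ((Finset.univ.filter fun Ψ : (Fin K × Fin K) ≃ Fin (K ^ 2) =>
        IsPNE (pot Ψ) p ∧ IsPNE (pot Ψ) q).card : ℝ) =
      ((K : ℝ) - 1) ^ 2 * ((Fintype.card ((Fin K × Fin K) ≃ Fin (K ^ 2)) : ℝ) /
        ((2 * K - 1) * (2 * K - 2))) := by
    rw [Finset.sum_congr rfl fun q hq => eq_div_of_mul_eq (mul_ne_zero h1 h2)
      (card_isPNE_and_isPNE_mul (Finset.mem_compl.1 hq)), Finset.sum_const, nsmul_eq_mul]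
    congr 1
    have hc : ((cross p).card : ℝ) + 1 = 2 * K := mod_cast card_cross p
    have hs : ((cross p).card : ℝ) + (cross p)ᶜ.card = K * K := by
      have := Finset.card_add_card_compl (cross p)
      simp only [Fintype.card_prod, Fintype.card_fin] at this
      exact mod_cast this
    linear_combination hs - hc
  rw [hin, hout, show (2 * K - 2 : ℝ) = 2 * (K - 1) by ring]
  field_simp
  ring

lemma sum_numPNE_sq {K : ℕ} (hK : 2 ≤ K) :
    ∑ Ψ : (Fin K × Fin K) ≃ Fin (K ^ 2), (numPNE Ψ : ℝ) ^ 2 =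
      K ^ 2 * ((K + 1) / (2 * (2 * K - 1))) *
        Fintype.card ((Fin K × Fin K) ≃ Fin (K ^ 2)) := by
  calc _ = ∑ p : Fin K × Fin K, ∑ q : Fin K × Fin K, ((Finset.univ.filter
        fun Ψ : (Fin K × Fin K) ≃ Fin (K ^ 2) =>
          IsPNE (pot Ψ) p ∧ IsPNE (pot Ψ) q).card : ℝ) := by
        simp_rw [numPNE, Finset.card_filter, Nat.cast_sum, sq, Finset.sum_mul_sum]
        rw [Finset.sum_comm]
        refine Finset.sum_congr rfl fun p _ => ?_
        rw [Finset.sum_comm]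
        refine Finset.sum_congr rfl fun q _ => Finset.sum_congr rfl fun Ψ _ => ?_
        by_cases hp : IsPNE (pot Ψ) p <;> by_cases hq : IsPNE (pot Ψ) q <;> simp [hp, hq]
    _ = _ := by
        simp_rw [sum_card_isPNE_and_isPNE hK]
        simp only [Finset.sum_const, Finset.card_univ, Fintype.card_prod, Fintype.card_fin,
          nsmul_eq_mul, Nat.cast_mul]
        ring

/-- The second moment of `W_K / K - 1/2` equals `1 / (4 (2 K - 1))`. -/
lemma sum_numPNE_div_sub_half_sq {K : ℕ} (hK : 2 ≤ K) :
    ∑ Ψ : (Fin K × Fin K) ≃ Fin (K ^ 2), ((numPNE Ψ : ℝ) / K - 1 / 2) ^ 2 =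
      1 / (4 * (2 * (K : ℝ) - 1)) * Fintype.card ((Fin K × Fin K) ≃ Fin (K ^ 2)) := by
  have hK' : (2 : ℝ) ≤ K := mod_cast hK
  have h0 : (K : ℝ) ≠ 0 := by linarith
  have hexp : ∀ Ψ : (Fin K × Fin K) ≃ Fin (K ^ 2), ((numPNE Ψ : ℝ) / K - 1 / 2) ^ 2 =
      1 / (K : ℝ) ^ 2 * (numPNE Ψ : ℝ) ^ 2 - 1 / K * numPNE Ψ + 1 / 4 := by
    intro Ψ
    ring
  simp_rw [hexp]
  rw [Finset.sum_add_distrib, Finset.sum_sub_distrib, ← Finset.mul_sum, ← Finset.mul_sum,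
    sum_numPNE hK, sum_numPNE_sq hK, Finset.sum_const, Finset.card_univ, nsmul_eq_mul]
  have h1 : (K * 2 - 1 : ℝ) ≠ 0 := by linarith
  field_simp
  ring

/-- Chebyshev bound for `W_K / K` around `1/2`. -/
lemma one_sub_le_prob_numPNE {K : ℕ} (hK : 2 ≤ K) {δ : ℝ} (hδ : 0 < δ) :
    1 - 1 / (4 * (2 * K - 1)) / δ ^ 2 ≤
      ((Finset.univ.filter fun Ψ : (Fin K × Fin K) ≃ Fin (K ^ 2) =>
        |(numPNE Ψ : ℝ) / K - 1 / 2| < δ).card : ℝ) /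
          (Fintype.card ((Fin K × Fin K) ≃ Fin (K ^ 2)) : ℝ) := by
  have hM : (0 : ℝ) < Fintype.card ((Fin K × Fin K) ≃ Fin (K ^ 2)) := by
    have : Nonempty ((Fin K × Fin K) ≃ Fin (K ^ 2)) :=
      ⟨Fintype.equivOfCardEq (by simp [sq])⟩
    exact mod_cast Fintype.card_pos
  have hsum := Finset.card_filter_add_card_filter_not (s := Finset.univ)
    fun Ψ : (Fin K × Fin K) ≃ Fin (K ^ 2) => |(numPNE Ψ : ℝ) / K - 1 / 2| < δ
  rw [Finset.card_univ] at hsum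
  have hsum' := congrArg (Nat.cast : ℕ → ℝ) hsum
  push_cast at hsum'
  have hbad : ((Finset.univ.filter fun Ψ : (Fin K × Fin K) ≃ Fin (K ^ 2) =>
      ¬ |(numPNE Ψ : ℝ) / K - 1 / 2| < δ).card : ℝ) * δ ^ 2 ≤
      1 / (4 * (2 * K - 1)) * Fintype.card ((Fin K × Fin K) ≃ Fin (K ^ 2)) := by
    rw [← sum_numPNE_div_sub_half_sq hK, ← nsmul_eq_mul]
    refine (Finset.card_nsmul_le_sum _ (fun Ψ => ((numPNE Ψ : ℝ) / K - 1 / 2) ^ 2) _ ?_).trans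
      (Finset.sum_le_sum_of_subset_of_nonneg (Finset.filter_subset _ _) fun _ _ _ => sq_nonneg _)
    intro Ψ hΨ
    rw [Finset.mem_filter, not_lt] at hΨ
    rw [← sq_abs (_ / _ - _)]
    exact pow_le_pow_left₀ hδ.le hΨ.2 2
  rw [← le_div_iff₀ (by positivity)] at hbad
  rw [le_div_iff₀ hM]
  have : 1 / (4 * (2 * K - 1)) * (Fintype.card ((Fin K × Fin K) ≃ Fin (K ^ 2)) : ℝ) / δ ^ 2 =
      1 / (4 * (2 * K - 1)) / δ ^ 2 * Fintype.card ((Fin K × Fin K) ≃ Fin (K ^ 2)) := by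
    ring
  linarith

/-- The number of PNE of a uniformly random bijection `Ψ : [K]×[K] → {1,…,K²}`,
rescaled by `K`, converges in probability to `1/2`:
for every `δ > 0`, `P(|W_K/K - 1/2| < δ) → 1` as `K → ∞`. -/
theorem stmt2 (δ : ℝ) (hδ : 0 < δ) :
    Filter.Tendsto (fun K : ℕ =>
        ((Finset.univ.filter fun Ψ : (Fin K × Fin K) ≃ Fin (K ^ 2) =>
            |((Finset.univ.filter fun p : Fin K × Fin K => IsPNE (pot Ψ) p).card : ℝ) / K
              - 1 / 2| < δ).card : ℝ) /
          (Fintype.card ((Fin K × Fin K) ≃ Fin (K ^ 2)) : ℝ))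
      Filter.atTop (nhds 1) := by
  refine tendsto_of_tendsto_of_tendsto_of_le_of_le'
    (g := fun K : ℕ => 1 - 1 / (4 * (2 * (K : ℝ) - 1)) / δ ^ 2) (h := fun _ => 1) ?_
    tendsto_const_nhds ?_ ?_
  · have hlin : Filter.Tendsto (fun K : ℕ => 4 * (2 * (K : ℝ) - 1)) Filter.atTop Filter.atTop :=
      (Filter.tendsto_atTop_add_const_right _ (-1)
        (tendsto_natCast_atTop_atTop.const_mul_atTop two_pos)).const_mul_atTop four_pos
    simpa using ((hlin.inv_tendsto_atTop).div_const (δ ^ 2)).const_sub 1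
  · filter_upwards [Filter.eventually_ge_atTop 2] with K hK
    exact one_sub_le_prob_numPNE hK hδ
  · filter_upwards with K
    exact div_le_one_of_le₀ (mod_cast Finset.card_le_univ _) (Nat.cast_nonneg _)
end
end

section
/- Let Ψ : [K]×[K] → ℝ be injective (K ≥ 1) and let (BRD(t))_{t≥0} be the best-response dynamics started at any profile (a₀,b₀). Then there exists t̂ ≤ 2K such that BRD(t) = BRD(t̂) for all t ≥ t̂, and BRD(t̂) is a pure Nash equilibrium of Ψ; in particular BRD(2K) is a pure Nash equilibrium of Ψ. -/
open scoped Classical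

noncomputable section

/-- A step of an alternating best-response sequence does not increase the potential. -/
theorem antitone_potential_of_bestResponse {K : ℕ} {Ψ : Fin K × Fin K → ℝ}
    {BRD : ℕ → Fin K × Fin K}
    (heven : ∀ t, Even t → ∀ a : Fin K, Ψ (BRD (t + 1)) ≤ Ψ (a, (BRD t).2))
    (hodd : ∀ t, Odd t → ∀ b : Fin K, Ψ (BRD (t + 1)) ≤ Ψ ((BRD t).1, b)) :
    Antitone fun t => Ψ (BRD t) := by
  refine antitone_nat_of_succ_le fun t => ?_
  rcases Nat.even_or_odd t with ht | ht
  · exact heven t ht (BRD t).1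
  · exact hodd t ht (BRD t).2

/-- A profile minimizing an injective potential in its row and column is a pure Nash
equilibrium. -/
theorem isPNE_of_le {K : ℕ} {Ψ : Fin K × Fin K → ℝ} (hΨ : Function.Injective Ψ)
    {p : Fin K × Fin K} (hcol : ∀ a, Ψ p ≤ Ψ (a, p.2)) (hrow : ∀ b, Ψ p ≤ Ψ (p.1, b)) :
    IsPNE Ψ p :=
  ⟨fun a ha => (hcol a).lt_of_ne fun h => ha (congrArg Prod.fst (hΨ h)).symm,
    fun b hb => (hrow b).lt_of_ne fun h => hb (congrArg Prod.snd (hΨ h)).symm⟩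

/-- The best-response dynamics of an injective potential, started anywhere, is
absorbed at a pure Nash equilibrium within `2K` steps.
Here `BRD` is characterized by: `BRD 0 = (a₀,b₀)`; for even `t` the second
coordinate is unchanged and the first coordinate of `BRD (t+1)` is the (unique)
minimizer of the potential in the current column; for odd `t`, symmetrically. -/
theorem stmt4 (K : ℕ) (hK : 1 ≤ K) (Ψ : Fin K × Fin K → ℝ)
    (hΨ : Function.Injective Ψ) (a₀ b₀ : Fin K)
    (BRD : ℕ → Fin K × Fin K)
    (h0 : BRD 0 = (a₀, b₀))
    (heven : ∀ t, Even t →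
      (BRD (t + 1)).2 = (BRD t).2 ∧ ∀ a : Fin K, Ψ (BRD (t + 1)) ≤ Ψ (a, (BRD t).2))
    (hodd : ∀ t, Odd t →
      (BRD (t + 1)).1 = (BRD t).1 ∧ ∀ b : Fin K, Ψ (BRD (t + 1)) ≤ Ψ ((BRD t).1, b)) :
    ∃ tHat, tHat ≤ 2 * K ∧ (∀ t, tHat ≤ t → BRD t = BRD tHat) ∧
      IsPNE Ψ (BRD tHat) ∧ IsPNE Ψ (BRD (2 * K)) := by
  have hanti := antitone_potential_of_bestResponse (fun t ht => (heven t ht).2)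
    fun t ht => (hodd t ht).2
  have hcolmin : ∀ i a, Ψ (BRD (2 * i + 1)) ≤ Ψ (a, (BRD (2 * i + 1)).2) := fun i a => by
    rw [(heven (2 * i) (even_two_mul i)).1]
    exact (heven (2 * i) (even_two_mul i)).2 a
  obtain ⟨i, j, hij, hjK, hcol⟩ :
      ∃ i j, i < j ∧ j ≤ K ∧ (BRD (2 * i + 1)).2 = (BRD (2 * j + 1)).2 := by
    obtain ⟨i, j, hne, h⟩ := Fintype.exists_ne_map_eq_of_card_lt
      (fun i : Fin (K + 1) => (BRD (2 * (i : ℕ) + 1)).2) (by simp)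
    rcases hne.lt_or_gt with hlt | hlt
    · exact ⟨i, j, hlt, Nat.lt_succ_iff.mp j.isLt, h⟩
    · exact ⟨j, i, hlt, Nat.lt_succ_iff.mp i.isLt, h.symm⟩
  have hstep : BRD (2 * i + 1 + 1) = BRD (2 * i + 1) := by
    refine hΨ (le_antisymm (hanti (Nat.le_succ _)) ?_)
    calc Ψ (BRD (2 * i + 1)) ≤ Ψ ((BRD (2 * j + 1)).1, (BRD (2 * i + 1)).2) := hcolmin i _
      _ = Ψ (BRD (2 * j + 1)) := by rw [hcol]
      _ ≤ Ψ (BRD (2 * i + 1 + 1)) := hanti (by omega)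
  have hrowmin : ∀ b, Ψ (BRD (2 * i + 1)) ≤ Ψ ((BRD (2 * i + 1)).1, b) := fun b => by
    have h := (hodd (2 * i + 1) (odd_two_mul_add_one i)).2 b
    rwa [hstep] at h
  have hfix : ∀ t, 2 * i + 1 ≤ t → BRD t = BRD (2 * i + 1) := fun t ht => by
    induction t, ht using Nat.le_induction with
    | base => rfl
    | succ t ht ih =>
      refine hΨ (le_antisymm (hanti (by omega)) ?_)
      rcases Nat.even_or_odd t with h | h
      · have hmin := hcolmin i (BRD (t + 1)).1
        rwa [← ih, ← (heven t h).1, ih] at hmin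
      · have hmin := hrowmin (BRD (t + 1)).2
        rwa [← ih, ← (hodd t h).1, ih] at hmin
  have hpne := isPNE_of_le hΨ (hcolmin i) hrowmin
  refine ⟨2 * i + 1, by omega, hfix, hpne, ?_⟩
  rw [hfix (2 * K) (by omega)]
  exact hpne
end
end

section
/- Let Ψ_K be a uniformly random bijection from [K]×[K] to {1,…,K²}. For ε ∈ (0,1/2), let η_{⌊εK⌋} denote the pure Nash equilibrium of Ψ_K with the ⌊εK⌋-th smallest potential value (setting |BoA_K(η_{⌊εK⌋})| = 0 on the event that Ψ_K has fewer than ⌊εK⌋ pure Nash equilibria). Then lim_{K→∞} E[ |BoA_K(η_{⌊εK⌋})| / K ] = exp(√(1−2ε)). -/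
open scoped Classical

noncomputable section

/-- The minimizer of the potential `Ψ` in column `b` (the best response of the
row player to `b`). -/
noncomputable def argminRow {K : ℕ} (Ψ : Fin K × Fin K → ℝ) (b : Fin K) : Fin K :=
  have : Nonempty (Fin K) := ⟨b⟩
  Classical.choose (Finite.exists_min fun a : Fin K => Ψ (a, b))

/-- The minimizer of the potential `Ψ` in row `a` (the best response of the
column player to `a`). -/
noncomputable def argminCol {K : ℕ} (Ψ : Fin K × Fin K → ℝ) (a : Fin K) : Fin K :=
  have : Nonempty (Fin K) := ⟨a⟩
  Classical.choose (Finite.exists_min fun b : Fin K => Ψ (a, b))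

/-- Best-response dynamics for the potential `Ψ` started at `p₀`: at even times the
row player moves to the minimizer of the current column, at odd times the column
player moves to the minimizer of the current row (staying put if already there). -/
noncomputable def BRD {K : ℕ} (Ψ : Fin K × Fin K → ℝ) (p₀ : Fin K × Fin K) :
    ℕ → Fin K × Fin K
  | 0 => p₀
  | t + 1 =>
    let p := BRD Ψ p₀ t
    if Even t then (argminRow Ψ p.2, p.2) else (p.1, argminCol Ψ p.1)

/-- The set of pure Nash equilibria of the potential given by the bijection `Ψ`. -/
def pneFinset {K : ℕ} (Ψ : (Fin K × Fin K) ≃ Fin (K ^ 2)) : Finset (Fin K × Fin K) :=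
  Finset.univ.filter fun p => IsPNE (pot Ψ) p

/-- The rank of `η` among the PNE of `Ψ`, ordered by increasing potential value
(the PNE with smallest potential has rank `1`). -/
def rankPNE {K : ℕ} (Ψ : (Fin K × Fin K) ≃ Fin (K ^ 2)) (η : Fin K × Fin K) : ℕ :=
  ((pneFinset Ψ).filter fun p => Ψ p ≤ Ψ η).card

/-- The basin of attraction of `η`: the set of profiles from which the
best-response dynamics is absorbed at `η` (within `2K` steps). -/
noncomputable def BoA {K : ℕ} (Ψ : (Fin K × Fin K) ≃ Fin (K ^ 2))
    (η : Fin K × Fin K) : Finset (Fin K × Fin K) :=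
  Finset.univ.filter fun p => BRD (pot Ψ) p (2 * K) = η

/-- The size of the basin of attraction of the PNE of `Ψ` with the `j`-th smallest
potential value, set to `0` if `Ψ` has fewer than `j` PNE. -/
noncomputable def basinOfRank {K : ℕ} (Ψ : (Fin K × Fin K) ≃ Fin (K ^ 2)) (j : ℕ) : ℕ :=
  ∑ η ∈ (pneFinset Ψ).filter fun η => rankPNE Ψ η = j, (BoA Ψ η).card

/-- The state of the exploration of a potential in increasing order of its values.
Each row and each column carries the rank of the equilibrium that attracts it, with `0` for
a row or column none of whose cells has been seen; `count` is the number of equilibria seen. -/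
structure LabelState (K : ℕ) where
  row : Fin K → ℕ
  col : Fin K → ℕ
  count : ℕ

namespace LabelState

variable {K : ℕ}

/-- The update of the labels when the cell `p` is revealed. -/
def step (s : LabelState K) (p : Fin K × Fin K) : LabelState K :=
  if s.row p.1 = 0 then
    if s.col p.2 = 0 then
      ⟨Function.update s.row p.1 (s.count + 1), Function.update s.col p.2 (s.count + 1),
        s.count + 1⟩
    else ⟨Function.update s.row p.1 (s.col p.2), s.col, s.count⟩
  else if s.col p.2 = 0 then ⟨s.row, Function.update s.col p.2 (s.row p.1), s.count⟩
  else s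

/-- All labels are ranks of equilibria already seen. -/
def Valid (s : LabelState K) : Prop :=
  (∀ a, s.row a ≤ s.count) ∧ ∀ b, s.col b ≤ s.count

/-- The state in which nothing has been revealed. -/
def start (K : ℕ) : LabelState K := ⟨fun _ => 0, fun _ => 0, 0⟩

lemma valid_start : (start K).Valid := by simp [Valid, start]

lemma Valid.step {s : LabelState K} (hs : s.Valid) (p : Fin K × Fin K) : (s.step p).Valid := by
  obtain ⟨h1, h2⟩ := hs
  unfold LabelState.step
  split_ifs
  · refine ⟨fun a => ?_, fun b => ?_⟩
    · simp only [Function.update_apply]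
      have := h1 a
      split_ifs <;> omega
    · simp only [Function.update_apply]
      have := h2 b
      split_ifs <;> omega
  · refine ⟨fun a => ?_, h2⟩
    simp only [Function.update_apply]
    have := h1 a
    have := h2 p.2
    split_ifs <;> omega
  · refine ⟨h1, fun b => ?_⟩
    simp only [Function.update_apply]
    have := h1 p.1
    have := h2 b
    split_ifs <;> omega
  · exact ⟨h1, h2⟩

lemma step_of_ne_zero {s : LabelState K} {p : Fin K × Fin K} (h1 : s.row p.1 ≠ 0)
    (h2 : s.col p.2 ≠ 0) : s.step p = s := by
  simp [step, h1, h2]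

lemma row_step_of_ne_zero {s : LabelState K} {a : Fin K} (h : s.row a ≠ 0) (p : Fin K × Fin K) :
    (s.step p).row a = s.row a := by
  unfold step
  split_ifs with h1 <;> try rfl
  all_goals
    refine Function.update_of_ne ?_ _ _
    rintro rfl
    exact h h1

lemma col_step_of_ne_zero {s : LabelState K} {b : Fin K} (h : s.col b ≠ 0) (p : Fin K × Fin K) :
    (s.step p).col b = s.col b := by
  unfold step
  split_ifs with h1 h2 h2 <;> try rfl
  all_goals
    refine Function.update_of_ne ?_ _ _
    rintro rfl
    exact h h2

lemma row_step_of_ne {s : LabelState K} {a : Fin K} {p : Fin K × Fin K} (h : a ≠ p.1) :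
    (s.step p).row a = s.row a := by
  unfold step
  split_ifs <;> simp [h]

lemma col_step_of_ne {s : LabelState K} {b : Fin K} {p : Fin K × Fin K} (h : b ≠ p.2) :
    (s.step p).col b = s.col b := by
  unfold step
  split_ifs <;> simp [h]

lemma row_step_self_ne_zero (s : LabelState K) (p : Fin K × Fin K) :
    (s.step p).row p.1 ≠ 0 := by
  unfold step
  split_ifs <;> simp_all

lemma col_step_self_ne_zero (s : LabelState K) (p : Fin K × Fin K) :
    (s.step p).col p.2 ≠ 0 := by
  unfold step
  split_ifs <;> simp_all

lemma row_step_self_eq_col (s : LabelState K) (p : Fin K × Fin K)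
    (h : s.row p.1 = 0 ∨ s.col p.2 = 0) : (s.step p).row p.1 = (s.step p).col p.2 := by
  unfold step
  split_ifs <;> simp_all

end LabelState

/-- The labels after the cells of the `n` smallest potential values have been revealed. -/
def labels {K : ℕ} (Ψ : (Fin K × Fin K) ≃ Fin (K ^ 2)) : ℕ → LabelState K
  | 0 => LabelState.start K
  | n + 1 => if h : n < K ^ 2 then (labels Ψ n).step (Ψ.symm ⟨n, h⟩) else labels Ψ n

section Exploration

variable {K : ℕ}

lemma labels_succ (Ψ : (Fin K × Fin K) ≃ Fin (K ^ 2)) {n : ℕ} (h : n < K ^ 2) :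
    labels Ψ (n + 1) = (labels Ψ n).step (Ψ.symm ⟨n, h⟩) := by
  simp [labels, h]

lemma labels_succ_apply (Ψ : (Fin K × Fin K) ≃ Fin (K ^ 2)) (p : Fin K × Fin K) :
    labels Ψ ((Ψ p : ℕ) + 1) = (labels Ψ (Ψ p)).step p := by
  rw [labels_succ Ψ (Ψ p).isLt]
  simp

lemma valid_labels (Ψ : (Fin K × Fin K) ≃ Fin (K ^ 2)) (n : ℕ) : (labels Ψ n).Valid := by
  induction n with
  | zero => exact LabelState.valid_start
  | succ n ih =>
    by_cases h : n < K ^ 2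
    · rw [labels_succ Ψ h]
      exact ih.step _
    · simpa [labels, h] using ih

lemma labels_congr {Ψ Ψ' : (Fin K × Fin K) ≃ Fin (K ^ 2)} {n : ℕ}
    (h : ∀ i : Fin (K ^ 2), (i : ℕ) < n → Ψ.symm i = Ψ'.symm i) : labels Ψ n = labels Ψ' n := by
  induction n with
  | zero => rfl
  | succ n ih =>
    have ih' := ih fun i hi => h i (by omega)
    by_cases hn : n < K ^ 2
    · rw [labels_succ Ψ hn, labels_succ Ψ' hn, ih', h ⟨n, hn⟩ (by simp)]
    · simpa [labels, hn] using ih'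

lemma row_labels_ne_zero_iff (Ψ : (Fin K × Fin K) ≃ Fin (K ^ 2)) (n : ℕ) (a : Fin K) :
    (labels Ψ n).row a ≠ 0 ↔ ∃ b, (Ψ (a, b) : ℕ) < n := by
  induction n with
  | zero => simp [labels, LabelState.start]
  | succ n ih =>
    by_cases hn : n < K ^ 2
    · rw [labels_succ Ψ hn]
      constructor
      · intro h
        by_cases ha : a = (Ψ.symm ⟨n, hn⟩).1
        · refine ⟨(Ψ.symm ⟨n, hn⟩).2, ?_⟩
          rw [ha, Prod.mk.eta]
          simp
        · rw [LabelState.row_step_of_ne ha, ih] at h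
          obtain ⟨b, hb⟩ := h
          exact ⟨b, by omega⟩
      · rintro ⟨b, hb⟩
        rcases Nat.lt_succ_iff_lt_or_eq.mp hb with hb | hb
        · have := ih.mpr ⟨b, hb⟩
          rwa [LabelState.row_step_of_ne_zero this]
        · have : Ψ.symm ⟨n, hn⟩ = (a, b) := by
            rw [Equiv.symm_apply_eq]
            exact Fin.ext hb.symm
          rw [this]
          exact LabelState.row_step_self_ne_zero _ (a, b)
    · simp only [labels, hn, dite_false, ih]
      constructor
      · rintro ⟨b, hb⟩
        exact ⟨b, by omega⟩
      · rintro ⟨b, -⟩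
        have := (Ψ (a, b)).isLt
        exact ⟨b, by omega⟩

lemma col_labels_ne_zero_iff (Ψ : (Fin K × Fin K) ≃ Fin (K ^ 2)) (n : ℕ) (b : Fin K) :
    (labels Ψ n).col b ≠ 0 ↔ ∃ a, (Ψ (a, b) : ℕ) < n := by
  induction n with
  | zero => simp [labels, LabelState.start]
  | succ n ih =>
    by_cases hn : n < K ^ 2
    · rw [labels_succ Ψ hn]
      constructor
      · intro h
        by_cases hb : b = (Ψ.symm ⟨n, hn⟩).2
        · refine ⟨(Ψ.symm ⟨n, hn⟩).1, ?_⟩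
          rw [hb, Prod.mk.eta]
          simp
        · rw [LabelState.col_step_of_ne hb, ih] at h
          obtain ⟨a, ha⟩ := h
          exact ⟨a, by omega⟩
      · rintro ⟨a, ha⟩
        rcases Nat.lt_succ_iff_lt_or_eq.mp ha with ha | ha
        · have := ih.mpr ⟨a, ha⟩
          rwa [LabelState.col_step_of_ne_zero this]
        · have : Ψ.symm ⟨n, hn⟩ = (a, b) := by
            rw [Equiv.symm_apply_eq]
            exact Fin.ext ha.symm
          rw [this]
          exact LabelState.col_step_self_ne_zero _ (a, b)
    · simp only [labels, hn, dite_false, ih]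
      constructor
      · rintro ⟨a, ha⟩
        exact ⟨a, by omega⟩
      · rintro ⟨a, -⟩
        have := (Ψ (a, b)).isLt
        exact ⟨a, by omega⟩

lemma labels_step_of_lt (Ψ : (Fin K × Fin K) ≃ Fin (K ^ 2)) {n : ℕ} {p : Fin K × Fin K}
    (h : (Ψ p : ℕ) < n) : (labels Ψ n).step p = labels Ψ n :=
  LabelState.step_of_ne_zero ((row_labels_ne_zero_iff Ψ n p.1).mpr ⟨p.2, h⟩)
    ((col_labels_ne_zero_iff Ψ n p.2).mpr ⟨p.1, h⟩)

/-- Given the first `n` cells of a uniformly random ordering, the next cell is uniform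
among the remaining ones. -/
lemma sum_next_cell (F : LabelState K → Fin K × Fin K → ℝ) {n : ℕ} (hn : n < K ^ 2) :
    ((K ^ 2 - n : ℕ) : ℝ) * ∑ Ψ : (Fin K × Fin K) ≃ Fin (K ^ 2),
        F (labels Ψ n) (Ψ.symm ⟨n, hn⟩) =
      ∑ Ψ : (Fin K × Fin K) ≃ Fin (K ^ 2),
        ∑ p with n ≤ (Ψ p : ℕ), F (labels Ψ n) p := by
  have swap_eq : ∀ m ∈ Finset.Ici (⟨n, hn⟩ : Fin (K ^ 2)),
      ∑ Ψ : (Fin K × Fin K) ≃ Fin (K ^ 2), F (labels Ψ n) (Ψ.symm ⟨n, hn⟩) =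
        ∑ Ψ : (Fin K × Fin K) ≃ Fin (K ^ 2), F (labels Ψ n) (Ψ.symm m) := by
    intro m hm
    rw [Finset.mem_Ici] at hm
    refine Fintype.sum_bijective (fun Ψ => Ψ.trans (Equiv.swap ⟨n, hn⟩ m)) ?_ _ _ ?_
    · refine Function.Involutive.bijective fun Ψ => ?_
      ext p
      simp
    · intro Ψ
      have hl : labels (Ψ.trans (Equiv.swap ⟨n, hn⟩ m)) n = labels Ψ n := by
        refine labels_congr fun i hi => ?_
        have h1 : i ≠ ⟨n, hn⟩ := by
          rintro rfl
          simp at hi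
        have h2 : i ≠ m := by
          rintro rfl
          exact absurd (Fin.le_def.mp hm) (by simpa using hi)
        simp [Equiv.swap_apply_of_ne_of_ne h1 h2]
      rw [hl]
      simp
  have hcard : (Finset.Ici (⟨n, hn⟩ : Fin (K ^ 2))).card = K ^ 2 - n := by simp
  rw [← hcard, ← nsmul_eq_mul, ← Finset.sum_const, Finset.sum_congr rfl swap_eq, Finset.sum_comm]
  refine Finset.sum_congr rfl fun Ψ _ => ?_
  refine Finset.sum_bij (fun m _ => Ψ.symm m) ?_ ?_ ?_ ?_
  · intro m hm
    simpa [Fin.le_def] using hm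
  · intro m _ m' _ h
    exact Ψ.symm.injective h
  · intro p hp
    exact ⟨Ψ p, by simpa [Fin.le_def] using hp, by simp⟩
  · intro m _
    rfl

/-- The expectation of a superharmonic function of the labels does not increase along the
exploration of a uniformly random potential. -/
lemma sum_labels_le_of_superharmonic (Θ : LabelState K → ℝ)
    (hΘ : ∀ s : LabelState K, s.Valid → ∑ p, (Θ (s.step p) - Θ s) ≤ 0) {n : ℕ}
    (hn : n ≤ K ^ 2) :
    ∑ Ψ : (Fin K × Fin K) ≃ Fin (K ^ 2), Θ (labels Ψ n) ≤
      Fintype.card ((Fin K × Fin K) ≃ Fin (K ^ 2)) * Θ (LabelState.start K) := by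
  induction n with
  | zero => simp [labels]
  | succ n ih =>
    have hn' : n < K ^ 2 := by omega
    refine le_trans ?_ (ih hn'.le)
    rw [← sub_nonpos, ← Finset.sum_sub_distrib]
    have h := sum_next_cell (fun s p => Θ (s.step p) - Θ s) hn'
    have hpos : (0 : ℝ) < ((K ^ 2 - n : ℕ) : ℝ) := by
      exact_mod_cast Nat.sub_pos_of_lt hn'
    simp only [labels_succ _ hn']
    refine nonpos_of_mul_nonpos_right (a := ((K ^ 2 - n : ℕ) : ℝ)) ?_ hpos
    rw [h]
    refine Finset.sum_nonpos fun Ψ _ => ?_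
    rw [Finset.sum_filter_of_ne]
    · exact hΘ _ (valid_labels Ψ n)
    · intro p _ hp
      by_contra hlt
      rw [labels_step_of_lt Ψ (not_le.mp hlt)] at hp
      simp at hp

end Exploration

section Basins

variable {K : ℕ}

lemma pot_injective (Ψ : (Fin K × Fin K) ≃ Fin (K ^ 2)) : Function.Injective (pot Ψ) := by
  intro p q h
  have : ((Ψ p : ℕ) : ℝ) = (Ψ q : ℕ) := by simpa [pot] using h
  exact Ψ.injective (Fin.ext (by exact_mod_cast this))

lemma pot_le_pot_iff (Ψ : (Fin K × Fin K) ≃ Fin (K ^ 2)) (p q : Fin K × Fin K) :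
    pot Ψ p ≤ pot Ψ q ↔ (Ψ p : ℕ) ≤ Ψ q := by
  simp [pot]

lemma pot_lt_pot_iff (Ψ : (Fin K × Fin K) ≃ Fin (K ^ 2)) (p q : Fin K × Fin K) :
    pot Ψ p < pot Ψ q ↔ (Ψ p : ℕ) < Ψ q := by
  simp [pot]

lemma argminRow_le (Φ : Fin K × Fin K → ℝ) (a b : Fin K) : Φ (argminRow Φ b, b) ≤ Φ (a, b) := by
  have : Nonempty (Fin K) := ⟨b⟩
  exact Classical.choose_spec (Finite.exists_min fun a : Fin K => Φ (a, b)) a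

lemma argminCol_le (Φ : Fin K × Fin K → ℝ) (a b : Fin K) : Φ (a, argminCol Φ a) ≤ Φ (a, b) := by
  have : Nonempty (Fin K) := ⟨a⟩
  exact Classical.choose_spec (Finite.exists_min fun b : Fin K => Φ (a, b)) b

lemma isPNE_of_argmin_eq {Φ : Fin K × Fin K → ℝ} (hΦ : Function.Injective Φ)
    {p : Fin K × Fin K} (h1 : argminRow Φ p.2 = p.1) (h2 : argminCol Φ p.1 = p.2) :
    IsPNE Φ p := by
  refine ⟨fun a ha => lt_of_le_of_ne ?_ ?_, fun b hb => lt_of_le_of_ne ?_ ?_⟩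
  · have := argminRow_le Φ a p.2
    rwa [h1] at this
  · exact fun h => ha (congrArg Prod.fst (hΦ h)).symm
  · have := argminCol_le Φ p.1 b
    rwa [h2] at this
  · exact fun h => hb (congrArg Prod.snd (hΦ h)).symm

lemma BRD_succ_of_even (Φ : Fin K × Fin K → ℝ) (p : Fin K × Fin K) {t : ℕ} (ht : Even t) :
    BRD Φ p (t + 1) = (argminRow Φ (BRD Φ p t).2, (BRD Φ p t).2) := by
  simp [BRD, ht]

lemma BRD_succ_of_odd (Φ : Fin K × Fin K → ℝ) (p : Fin K × Fin K) {t : ℕ} (ht : ¬ Even t) :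
    BRD Φ p (t + 1) = ((BRD Φ p t).1, argminCol Φ (BRD Φ p t).1) := by
  simp only [BRD, ht, if_false]

lemma antitone_BRD (Φ : Fin K × Fin K → ℝ) (p : Fin K × Fin K) :
    Antitone fun t => Φ (BRD Φ p t) := by
  refine antitone_nat_of_succ_le fun t => ?_
  by_cases ht : Even t
  · rw [BRD_succ_of_even Φ p ht]
    exact argminRow_le Φ _ _
  · rw [BRD_succ_of_odd Φ p ht]
    exact argminCol_le Φ _ _

/-- The best-response dynamics of an injective potential is absorbed at an equilibrium
within `2K` steps. -/
lemma isPNE_BRD {Φ : Fin K × Fin K → ℝ} (hΦ : Function.Injective Φ) (p : Fin K × Fin K) :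
    IsPNE Φ (BRD Φ p (2 * K)) := by
  obtain ⟨i, j, hij, hcol⟩ : ∃ i j : Fin (K + 1), i < j ∧
      (BRD Φ p (2 * i)).2 = (BRD Φ p (2 * j)).2 := by
    obtain ⟨i, j, hne, h⟩ := Fintype.exists_ne_map_eq_of_card_lt
      (fun i : Fin (K + 1) => (BRD Φ p (2 * i)).2) (by simp)
    rcases lt_or_gt_of_ne hne with hlt | hlt
    · exact ⟨i, j, hlt, h⟩
    · exact ⟨j, i, hlt, h.symm⟩
  have hlt : (i : ℕ) < j := hij
  have heq : BRD Φ p (2 * i + 1) = BRD Φ p (2 * j + 1) := by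
    rw [BRD_succ_of_even Φ p (by simp), BRD_succ_of_even Φ p (by simp), hcol]
  have hnext : BRD Φ p (2 * i + 1 + 1) = BRD Φ p (2 * i + 1) := by
    refine hΦ (le_antisymm (antitone_BRD Φ p (by omega)) ?_)
    rw [heq]
    exact antitone_BRD Φ p (by omega)
  set q := BRD Φ p (2 * i + 1) with hq
  have hodd : ¬ Even (2 * (i : ℕ) + 1) := by simp
  have h2 : argminCol Φ q.1 = q.2 := by
    rw [BRD_succ_of_odd Φ p hodd] at hnext
    exact congrArg Prod.snd hnext
  have h1 : argminRow Φ q.2 = q.1 := by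
    have h := BRD_succ_of_even Φ p (t := 2 * i) (by simp)
    rw [← hq] at h
    conv_lhs => rw [h]
    conv_rhs => rw [h]
  have hstay : ∀ t, BRD Φ p (2 * i + 1 + t) = q := by
    intro t
    induction t with
    | zero => rfl
    | succ t ih =>
      rw [← Nat.add_assoc]
      by_cases ht : Even (2 * (i : ℕ) + 1 + t)
      · rw [BRD_succ_of_even Φ p ht, ih, h1]
      · rw [BRD_succ_of_odd Φ p ht, ih, h2]
  have hj := j.isLt
  have : 2 * K = 2 * i + 1 + (2 * K - (2 * i + 1)) := by omega
  rw [this, hstay]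
  exact isPNE_of_argmin_eq hΦ h1 h2

lemma row_labels_of_le (Ψ : (Fin K × Fin K) ≃ Fin (K ^ 2)) {n m : ℕ} (hnm : n ≤ m) {a : Fin K}
    (h : (labels Ψ n).row a ≠ 0) : (labels Ψ m).row a = (labels Ψ n).row a := by
  induction m, hnm using Nat.le_induction with
  | base => rfl
  | succ m _ ih =>
    by_cases hm : m < K ^ 2
    · rw [labels_succ Ψ hm, LabelState.row_step_of_ne_zero (by rwa [ih]), ih]
    · simpa [labels, hm] using ih

lemma col_labels_of_le (Ψ : (Fin K × Fin K) ≃ Fin (K ^ 2)) {n m : ℕ} (hnm : n ≤ m) {b : Fin K}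
    (h : (labels Ψ n).col b ≠ 0) : (labels Ψ m).col b = (labels Ψ n).col b := by
  induction m, hnm using Nat.le_induction with
  | base => rfl
  | succ m _ ih =>
    by_cases hm : m < K ^ 2
    · rw [labels_succ Ψ hm, LabelState.col_step_of_ne_zero (by rwa [ih]), ih]
    · simpa [labels, hm] using ih

lemma row_labels_final (Ψ : (Fin K × Fin K) ≃ Fin (K ^ 2)) (p : Fin K × Fin K) :
    (labels Ψ (K ^ 2)).row p.1 = ((labels Ψ (Ψ p)).step p).row p.1 := by
  rw [← labels_succ_apply]
  refine row_labels_of_le Ψ (Ψ p).isLt ?_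
  rw [labels_succ_apply]
  exact LabelState.row_step_self_ne_zero _ _

lemma col_labels_final (Ψ : (Fin K × Fin K) ≃ Fin (K ^ 2)) (p : Fin K × Fin K) :
    (labels Ψ (K ^ 2)).col p.2 = ((labels Ψ (Ψ p)).step p).col p.2 := by
  rw [← labels_succ_apply]
  refine col_labels_of_le Ψ (Ψ p).isLt ?_
  rw [labels_succ_apply]
  exact LabelState.col_step_self_ne_zero _ _

lemma row_labels_argminRow (Ψ : (Fin K × Fin K) ≃ Fin (K ^ 2)) (b : Fin K) :
    (labels Ψ (K ^ 2)).row (argminRow (pot Ψ) b) = (labels Ψ (K ^ 2)).col b := by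
  set p : Fin K × Fin K := (argminRow (pot Ψ) b, b) with hp
  have h1 := row_labels_final Ψ p
  have h2 := col_labels_final Ψ p
  rw [LabelState.row_step_self_eq_col, ← h2] at h1
  · exact h1
  · refine Or.inr (not_not.mp fun h => ?_)
    obtain ⟨a, ha⟩ := (col_labels_ne_zero_iff Ψ _ _).mp h
    have := (pot_le_pot_iff Ψ _ _).mp (argminRow_le (pot Ψ) a b)
    exact absurd ha (not_lt.mpr this)

lemma col_labels_argminCol (Ψ : (Fin K × Fin K) ≃ Fin (K ^ 2)) (a : Fin K) :
    (labels Ψ (K ^ 2)).col (argminCol (pot Ψ) a) = (labels Ψ (K ^ 2)).row a := by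
  set p : Fin K × Fin K := (a, argminCol (pot Ψ) a) with hp
  have h1 := row_labels_final Ψ p
  have h2 := col_labels_final Ψ p
  rw [LabelState.row_step_self_eq_col, ← h2] at h1
  · exact h1.symm
  · refine Or.inl (not_not.mp fun h => ?_)
    obtain ⟨b, hb⟩ := (row_labels_ne_zero_iff Ψ _ _).mp h
    have := (pot_le_pot_iff Ψ _ _).mp (argminCol_le (pot Ψ) a b)
    exact absurd hb (not_lt.mpr this)

lemma isPNE_pot_iff_s6 (Ψ : (Fin K × Fin K) ≃ Fin (K ^ 2)) (p : Fin K × Fin K) :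
    IsPNE (pot Ψ) p ↔ (labels Ψ (Ψ p)).row p.1 = 0 ∧ (labels Ψ (Ψ p)).col p.2 = 0 := by
  have h1 := (row_labels_ne_zero_iff Ψ (Ψ p) p.1).not
  have h2 := (col_labels_ne_zero_iff Ψ (Ψ p) p.2).not
  rw [not_not] at h1 h2
  rw [h1, h2, IsPNE]
  simp only [pot_lt_pot_iff]
  constructor
  · rintro ⟨h3, h4⟩
    constructor
    · rintro ⟨b, hb⟩
      by_cases hbp : b = p.2
      · subst hbp
        exact lt_irrefl _ hb
      · exact lt_asymm hb (h4 b hbp)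
    · rintro ⟨a, ha⟩
      by_cases hap : a = p.1
      · subst hap
        exact lt_irrefl _ ha
      · exact lt_asymm ha (h3 a hap)
  · rintro ⟨h3, h4⟩
    push Not at h3 h4
    refine ⟨fun a ha => lt_of_le_of_ne (h4 a) fun h => ha ?_,
      fun b hb => lt_of_le_of_ne (h3 b) fun h => hb ?_⟩
    · exact (congrArg Prod.fst (Ψ.injective (Fin.ext h))).symm
    · exact (congrArg Prod.snd (Ψ.injective (Fin.ext h))).symm

lemma count_labels (Ψ : (Fin K × Fin K) ≃ Fin (K ^ 2)) {n : ℕ} (hn : n ≤ K ^ 2) :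
    (labels Ψ n).count = ((pneFinset Ψ).filter fun p => (Ψ p : ℕ) < n).card := by
  induction n with
  | zero => simp [labels, LabelState.start]
  | succ n ih =>
    have hn' : n < K ^ 2 := hn
    have ih' := ih hn'.le
    set q := Ψ.symm ⟨n, hn'⟩ with hq
    have hΨq : (Ψ q : ℕ) = n := by simp [hq]
    have hsucc : ∀ p : Fin K × Fin K, (Ψ p : ℕ) < n + 1 ↔ p = q ∨ (Ψ p : ℕ) < n := by
      intro p
      have : p = q ↔ (Ψ p : ℕ) = n := by
        rw [hq, Equiv.eq_symm_apply, Fin.ext_iff]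
      rw [this]
      omega
    have hpne := isPNE_pot_iff_s6 Ψ q
    rw [hΨq] at hpne
    rw [labels_succ Ψ hn', ← hq]
    by_cases hP : IsPNE (pot Ψ) q
    · have hmem : q ∈ pneFinset Ψ := by simpa [pneFinset] using hP
      have : (pneFinset Ψ).filter (fun p => (Ψ p : ℕ) < n + 1) =
          insert q ((pneFinset Ψ).filter fun p => (Ψ p : ℕ) < n) := by
        ext p
        simp only [Finset.mem_filter, Finset.mem_insert, hsucc]
        constructor
        · tauto
        · rintro (rfl | h)
          · exact ⟨hmem, Or.inl rfl⟩
          · tauto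
      rw [this, Finset.card_insert_of_notMem (by simp [hΨq]), ← ih']
      obtain ⟨h1, h2⟩ := hpne.mp hP
      simp [LabelState.step, h1, h2]
    · have hmem : q ∉ pneFinset Ψ := by simpa [pneFinset] using hP
      have : (pneFinset Ψ).filter (fun p => (Ψ p : ℕ) < n + 1) =
          (pneFinset Ψ).filter fun p => (Ψ p : ℕ) < n := by
        ext p
        simp only [Finset.mem_filter, hsucc]
        constructor
        · rintro ⟨h1, rfl | h2⟩
          · exact absurd h1 hmem
          · exact ⟨h1, h2⟩
        · tauto
      rw [this, ← ih']
      rw [hpne] at hP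
      unfold LabelState.step
      split_ifs with h1 h2 <;> simp_all

lemma col_labels_of_isPNE (Ψ : (Fin K × Fin K) ≃ Fin (K ^ 2)) {p : Fin K × Fin K}
    (hp : IsPNE (pot Ψ) p) : (labels Ψ (K ^ 2)).col p.2 = rankPNE Ψ p := by
  obtain ⟨h1, h2⟩ := (isPNE_pot_iff_s6 Ψ p).mp hp
  have hc := count_labels Ψ (n := (Ψ p : ℕ) + 1) (Ψ p).isLt
  rw [labels_succ_apply] at hc
  rw [col_labels_final]
  simp only [LabelState.step, h1, h2, if_true, Function.update_self] at hc ⊢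
  rw [hc, rankPNE]
  congr 2
  ext q
  rw [Nat.lt_succ_iff, Fin.le_def]

lemma col_labels_BRD (Ψ : (Fin K × Fin K) ≃ Fin (K ^ 2)) (p : Fin K × Fin K) (t : ℕ) :
    (labels Ψ (K ^ 2)).col (BRD (pot Ψ) p (2 * t)).2 = (labels Ψ (K ^ 2)).col p.2 := by
  induction t with
  | zero => rfl
  | succ t ih =>
    rw [show 2 * (t + 1) = 2 * t + 1 + 1 by ring, BRD_succ_of_odd _ _ (by simp),
      BRD_succ_of_even _ _ (by simp)]
    simp only
    rw [col_labels_argminCol, row_labels_argminRow, ih]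

/-- The basin of the equilibrium of rank `j` consists of the columns with final label `j`. -/
lemma basinOfRank_eq (Ψ : (Fin K × Fin K) ≃ Fin (K ^ 2)) (j : ℕ) :
    basinOfRank Ψ j =
      K * (Finset.univ.filter fun b => (labels Ψ (K ^ 2)).col b = j).card := by
  unfold basinOfRank BoA
  rw [← Finset.card_biUnion]
  · have : ((pneFinset Ψ).filter fun η => rankPNE Ψ η = j).biUnion
        (fun η => Finset.univ.filter fun p => BRD (pot Ψ) p (2 * K) = η) =
        (Finset.univ : Finset (Fin K)) ×ˢ
          Finset.univ.filter fun b => (labels Ψ (K ^ 2)).col b = j := by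
      ext p
      have hP := isPNE_BRD (pot_injective Ψ) p
      have hc := col_labels_of_isPNE Ψ hP
      rw [col_labels_BRD] at hc
      simp [pneFinset, hP, hc]
    rw [this, Finset.card_product]
    simp
  · intro η _ η' _ hne
    rw [Function.onFun, Finset.disjoint_left]
    intro p hp hp'
    simp only [Finset.mem_filter, Finset.mem_univ, true_and] at hp hp'
    exact hne (hp.symm.trans hp')

end Basins

section Drift

variable {K : ℕ}

/-- The number of points at which `f` takes the value `i`. -/
def levelCard (f : Fin K → ℕ) (i : ℕ) : ℕ := (Finset.univ.filter fun x => f x = i).card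

lemma levelCard_le (f : Fin K → ℕ) (i : ℕ) : levelCard f i ≤ K :=
  (Finset.card_le_univ _).trans_eq (by simp)

lemma levelCard_eq_zero {f : Fin K → ℕ} {i : ℕ} (h : ∀ x, f x ≠ i) : levelCard f i = 0 := by
  simp [levelCard, h]

lemma sum_ite_eq_levelCard (f : Fin K → ℕ) (i : ℕ) :
    ∑ x, (if f x = i then (1 : ℝ) else 0) = levelCard f i := by
  simp [levelCard]

lemma levelCard_update_zero {f : Fin K → ℕ} {a : Fin K} {y : ℕ} (ha : f a = 0) (hy : y ≠ 0) :
    levelCard (Function.update f a y) 0 = levelCard f 0 - 1 := by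
  unfold levelCard
  rw [← Finset.card_erase_of_mem (a := a) (by simpa using ha)]
  congr 1
  ext x
  by_cases hx : x = a
  · subst hx
    simp [hy]
  · simp [hx]

lemma levelCard_update_of_ne_zero {f : Fin K → ℕ} {a : Fin K} {y j : ℕ} (ha : f a = 0)
    (hj : j ≠ 0) :
    levelCard (Function.update f a y) j = levelCard f j + if y = j then 1 else 0 := by
  unfold levelCard
  split_ifs with h
  · rw [← Finset.card_insert_of_notMem (a := a) (by simp [ha, hj.symm])]
    congr 1
    ext x
    by_cases hx : x = a
    · subst hx
      simp [h]
    · simp [hx]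
  · rw [Nat.add_zero]
    congr 1
    ext x
    by_cases hx : x = a
    · subst hx
      simp [h, ha, hj.symm]
    · simp [hx]

/-- The value of `Θ` at the numbers of unlabelled rows and columns, the number of equilibria,
and the numbers of columns and of rows with label `j`. -/
def LabelState.stat (j : ℕ) (Θ : ℕ → ℕ → ℕ → ℕ → ℕ → ℝ) (s : LabelState K) : ℝ :=
  Θ (levelCard s.row 0) (levelCard s.col 0) s.count (levelCard s.col j) (levelCard s.row j)

lemma sum_mul_prod (f g : Fin K → ℝ) :
    ∑ p : Fin K × Fin K, f p.1 * g p.2 = (∑ a, f a) * ∑ b, g b := by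
  rw [Fintype.sum_prod_type, Finset.sum_mul_sum]

lemma sum_step_stat_sub {j : ℕ} (hj : j ≠ 0) (Θ : ℕ → ℕ → ℕ → ℕ → ℕ → ℝ) (s : LabelState K)
    {u v c r : ℕ} (hu : levelCard s.row 0 = u) (hv : levelCard s.col 0 = v)
    (hc : levelCard s.col j = c) (hr : levelCard s.row j = r) :
    ∑ p, ((s.step p).stat j Θ - s.stat j Θ) =
      u * v * (Θ (u - 1) (v - 1) (s.count + 1) (c + if s.count + 1 = j then 1 else 0)
          (r + if s.count + 1 = j then 1 else 0) - Θ u v s.count c r) +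
        u * (K - v - c) * (Θ (u - 1) v s.count c r - Θ u v s.count c r) +
        u * c * (Θ (u - 1) v s.count c (r + 1) - Θ u v s.count c r) +
        (K - u - r) * v * (Θ u (v - 1) s.count c r - Θ u v s.count c r) +
        r * v * (Θ u (v - 1) s.count (c + 1) r - Θ u v s.count c r) := by
  set D₁ := Θ (u - 1) (v - 1) (s.count + 1) (c + if s.count + 1 = j then 1 else 0)
    (r + if s.count + 1 = j then 1 else 0) - Θ u v s.count c r with hD₁
  set D₂ := Θ (u - 1) v s.count c r - Θ u v s.count c r with hD₂
  set D₃ := Θ (u - 1) v s.count c (r + 1) - Θ u v s.count c r with hD₃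
  set D₄ := Θ u (v - 1) s.count c r - Θ u v s.count c r with hD₄
  set D₅ := Θ u (v - 1) s.count (c + 1) r - Θ u v s.count c r with hD₅
  let R : ℕ → Fin K → ℝ := fun i a => if s.row a = i then 1 else 0
  let C : ℕ → Fin K → ℝ := fun i b => if s.col b = i then 1 else 0
  have hpt : ∀ p : Fin K × Fin K, (s.step p).stat j Θ - s.stat j Θ =
      (R 0 p.1 * C 0 p.2) * D₁ + (R 0 p.1 * (1 - C 0 p.2 - C j p.2)) * D₂ +
        (R 0 p.1 * C j p.2) * D₃ + ((1 - R 0 p.1 - R j p.1) * C 0 p.2) * D₄ +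
        (R j p.1 * C 0 p.2) * D₅ := by
    intro p
    have hs : s.stat j Θ = Θ u v s.count c r := by simp [LabelState.stat, hu, hv, hc, hr]
    rw [hs]
    unfold LabelState.step LabelState.stat
    by_cases h1 : s.row p.1 = 0
    · by_cases h2 : s.col p.2 = 0
      · simp [R, C, h1, h2, hj.symm, levelCard_update_zero, levelCard_update_of_ne_zero, hj,
          hu, hv, hc, hr, hD₁]
      · by_cases h3 : s.col p.2 = j
        · simp [R, C, h1, h3, hj.symm, levelCard_update_zero, levelCard_update_of_ne_zero, hj,
            hu, hv, hc, hr, hD₃]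
        · simp [R, C, h1, h2, h3, hj.symm, levelCard_update_zero, levelCard_update_of_ne_zero,
            hj, hu, hv, hc, hr, hD₂]
    · by_cases h2 : s.col p.2 = 0
      · by_cases h3 : s.row p.1 = j
        · simp [R, C, h2, h3, hj.symm, levelCard_update_zero, levelCard_update_of_ne_zero, hj,
            hu, hv, hc, hr, hD₅]
        · simp [R, C, h1, h2, h3, hj.symm, levelCard_update_zero, levelCard_update_of_ne_zero,
            hj, hu, hv, hc, hr, hD₄]
      · simp [R, C, h1, h2, hu, hv, hc, hr]
  simp only [hpt, Finset.sum_add_distrib, ← Finset.sum_mul]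
  rw [sum_mul_prod (R 0) (C 0), sum_mul_prod (R 0) (fun b => 1 - C 0 b - C j b),
    sum_mul_prod (R 0) (C j), sum_mul_prod (fun a => 1 - R 0 a - R j a) (C 0),
    sum_mul_prod (R j) (C 0)]
  simp only [Finset.sum_sub_distrib, R, C, sum_ite_eq_levelCard, hu, hv, hc, hr]
  simp

end Drift

section Gain

/-- The reciprocal of `∏ (i K - ⌊i / 2⌋ ⌈i / 2⌉)` over `1 ≤ i ≤ m`: the probability that a given
alternating chain of `m` fresh rows and columns is a best-response path. -/
def chainCoeff (K m : ℕ) : ℝ :=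
  ∏ i ∈ Finset.range m, ((i + 1 : ℝ) * K - ((i + 1) / 2 : ℕ) * ((i + 2) / 2 : ℕ))⁻¹

/-- The expected number of best-response paths of length `m` ending in a given row or column
(according to the parity of `m`), starting in a column, through fresh rows and columns, when `u`
rows and `v` columns are fresh. -/
def chainTerm (K m u v : ℕ) : ℝ :=
  chainCoeff K m * u.descFactorial (m / 2) * v.descFactorial ((m + 1) / 2)

/-- The expected number of columns eventually attracted through a given column. -/
def colGain (K u v : ℕ) : ℝ := ∑ k ∈ Finset.range (K + 1), chainTerm K (2 * k) u v

/-- The expected number of columns eventually attracted through a given row. -/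
def rowGain (K u v : ℕ) : ℝ := ∑ k ∈ Finset.range (K + 1), chainTerm K (2 * k + 1) u v

lemma mul_pred_descFactorial (u p : ℕ) :
    (u : ℝ) * (u - 1).descFactorial p = (u - p) * u.descFactorial p := by
  rcases u with _ | u
  · rcases p with _ | p <;> simp
  · rcases le_or_gt p (u + 1) with h | h
    · have := Nat.succ_descFactorial u p
      have h' : ((u + 1 - p : ℕ) : ℝ) * (u + 1).descFactorial p = (u + 1) * u.descFactorial p := by
        exact_mod_cast this
      rw [Nat.cast_sub h] at h'
      simpa using h'.symm
    · rw [Nat.descFactorial_of_lt h, Nat.descFactorial_of_lt (by omega)]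
      simp

lemma descFactorial_succ_eq (u p : ℕ) :
    (u.descFactorial (p + 1) : ℝ) = u * (u - 1).descFactorial p := by
  rcases u with _ | u
  · simp
  · rw [Nat.succ_descFactorial_succ]
    simp

lemma chainTerm_drift (K m u v : ℕ) :
    u * v * (chainTerm K m (u - 1) (v - 1) - chainTerm K m u v) +
      u * (K - v) * (chainTerm K m (u - 1) v - chainTerm K m u v) +
      v * (K - u) * (chainTerm K m u (v - 1) - chainTerm K m u v) =
    -(m * K - ((m / 2 : ℕ) : ℝ) * ((m + 1) / 2 : ℕ)) * chainTerm K m u v := by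
  have hm : (m : ℝ) = ((m / 2 : ℕ) : ℝ) + ((m + 1) / 2 : ℕ) := by
    have : m = m / 2 + (m + 1) / 2 := by omega
    exact_mod_cast this
  unfold chainTerm
  rw [hm]
  set p := m / 2
  set q := (m + 1) / 2
  have hu := mul_pred_descFactorial u p
  have hv := mul_pred_descFactorial v q
  set X : ℝ := (u.descFactorial p : ℝ)
  set X' : ℝ := ((u - 1).descFactorial p : ℝ)
  set Y : ℝ := (v.descFactorial q : ℝ)
  set Y' : ℝ := ((v - 1).descFactorial q : ℝ)
  linear_combination chainCoeff K m * (v * Y' * hu + (u - p) * X * hv + (K - v) * Y * hu +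
    (K - u) * X * hv)

lemma colGain_drift (K u v : ℕ) :
    u * v * (colGain K (u - 1) (v - 1) - colGain K u v) +
      u * (K - v) * (colGain K (u - 1) v - colGain K u v) +
      v * (K - u) * (colGain K u (v - 1) - colGain K u v) + u * rowGain K (u - 1) v =
    u * chainTerm K (2 * K + 1) (u - 1) v := by
  have hterm : ∀ k ∈ Finset.range K, u * chainTerm K (2 * k + 1) (u - 1) v =
      (((2 * (k + 1) : ℕ) : ℝ) * K - (k + 1) * (k + 1)) * chainTerm K (2 * (k + 1)) u v := by
    intro k hk
    have hk' : (k + 1 : ℝ) ≤ K := by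
      exact_mod_cast Finset.mem_range.mp hk
    unfold chainTerm
    have h1 : (2 * k + 1) / 2 = k := by omega
    have h2 : (2 * k + 1 + 1) / 2 = k + 1 := by omega
    have h3 : 2 * (k + 1) / 2 = k + 1 := by omega
    have h4 : (2 * (k + 1) + 1) / 2 = k + 1 := by omega
    have h5 : chainCoeff K (2 * (k + 1)) =
        chainCoeff K (2 * k + 1) * (((2 * (k + 1) : ℕ) : ℝ) * K - (k + 1) * (k + 1))⁻¹ := by
      rw [show 2 * (k + 1) = 2 * k + 1 + 1 by ring, chainCoeff, Finset.prod_range_succ,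
        ← chainCoeff]
      have h6 : (2 * k + 1 + 2) / 2 = k + 1 := by omega
      rw [h2, h6]
      push_cast
      ring
    have hne : (((2 * (k + 1) : ℕ) : ℝ) * K - (k + 1) * (k + 1)) ≠ 0 := by
      push_cast
      have : (0 : ℝ) ≤ k := by positivity
      nlinarith
    rw [h1, h2, h3, h4, h5, descFactorial_succ_eq u]
    generalize ((2 * (k + 1) : ℕ) : ℝ) * K - (k + 1) * (k + 1) = w at hne ⊢
    field_simp
  have hrow : u * rowGain K (u - 1) v = u * chainTerm K (2 * K + 1) (u - 1) v +
      ∑ k ∈ Finset.range (K + 1),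
        (((2 * k : ℕ) : ℝ) * K - ((2 * k / 2 : ℕ) : ℝ) * ((2 * k + 1) / 2 : ℕ)) *
          chainTerm K (2 * k) u v := by
    rw [rowGain, Finset.mul_sum, Finset.sum_range_succ, Finset.sum_congr rfl hterm,
      Finset.sum_range_succ', add_comm]
    congr 1
    simp only [Nat.mul_zero, Nat.zero_div, Nat.cast_zero, zero_mul, sub_zero, add_zero]
    refine Finset.sum_congr rfl fun k _ => ?_
    have h3 : 2 * (k + 1) / 2 = k + 1 := by omega
    have h4 : (2 * (k + 1) + 1) / 2 = k + 1 := by omega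
    rw [h3, h4]
    push_cast
    rfl
  have hsum := Finset.sum_congr (rfl : Finset.range (K + 1) = Finset.range (K + 1))
    fun k _ => chainTerm_drift K (2 * k) u v
  simp only [Finset.sum_add_distrib, ← Finset.mul_sum, Finset.sum_sub_distrib, neg_mul,
    Finset.sum_neg_distrib] at hsum
  rw [hrow]
  unfold colGain
  linear_combination hsum

lemma rowGain_drift {K u v : ℕ} (hK : 0 < K) :
    u * v * (rowGain K (u - 1) (v - 1) - rowGain K u v) +
      u * (K - v) * (rowGain K (u - 1) v - rowGain K u v) +
      v * (K - u) * (rowGain K u (v - 1) - rowGain K u v) + v * colGain K u (v - 1) = 0 := by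
  have hterm : ∀ k ∈ Finset.range (K + 1), v * chainTerm K (2 * k) u (v - 1) =
      (((2 * k + 1 : ℕ) : ℝ) * K - (((2 * k + 1) / 2 : ℕ) : ℝ) * ((2 * k + 1 + 1) / 2 : ℕ)) *
        chainTerm K (2 * k + 1) u v := by
    intro k hk
    have hk' : (k : ℝ) ≤ K := by
      exact_mod_cast Finset.mem_range_succ_iff.mp hk
    have hK' : (1 : ℝ) ≤ K := by exact_mod_cast hK
    unfold chainTerm
    have h1 : 2 * k / 2 = k := by omega
    have h2 : (2 * k + 1) / 2 = k := by omega
    have h4 : (2 * k + 1 + 1) / 2 = k + 1 := by omega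
    have h5 : chainCoeff K (2 * k + 1) =
        chainCoeff K (2 * k) * (((2 * k + 1 : ℕ) : ℝ) * K - k * (k + 1 : ℕ))⁻¹ := by
      rw [chainCoeff, Finset.prod_range_succ, ← chainCoeff]
      have h6 : (2 * k + 2) / 2 = k + 1 := by omega
      rw [h2, h6]
      push_cast
      ring
    have hne : (((2 * k + 1 : ℕ) : ℝ) * K - k * (k + 1 : ℕ)) ≠ 0 := by
      push_cast
      have : (0 : ℝ) ≤ k := by positivity
      nlinarith
    rw [h1, h2, h4, h5, descFactorial_succ_eq v]
    field_simp
  have hcol : v * colGain K u (v - 1) = ∑ k ∈ Finset.range (K + 1),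
      (((2 * k + 1 : ℕ) : ℝ) * K - (((2 * k + 1) / 2 : ℕ) : ℝ) * ((2 * k + 1 + 1) / 2 : ℕ)) *
        chainTerm K (2 * k + 1) u v := by
    rw [colGain, Finset.mul_sum, Finset.sum_congr rfl hterm]
  have hsum := Finset.sum_congr (rfl : Finset.range (K + 1) = Finset.range (K + 1))
    fun k _ => chainTerm_drift K (2 * k + 1) u v
  simp only [Finset.sum_add_distrib, ← Finset.mul_sum, Finset.sum_sub_distrib, neg_mul,
    Finset.sum_neg_distrib] at hsum
  rw [hcol]
  unfold rowGain
  linear_combination hsum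

lemma chainTerm_eq_zero {K m u v : ℕ} (hv : v ≤ K) (hm : 2 * K < m) : chainTerm K m u v = 0 := by
  have : v < (m + 1) / 2 := by omega
  simp [chainTerm, Nat.descFactorial_of_lt this]

end Gain

section Barrier

variable {K : ℕ}

/-- A barrier `W` that is superharmonic for the numbers `u`, `v` of fresh rows and columns and
the number `P` of equilibria, and dominates `σ` times the expected gain of the equilibrium of
rank `j` at its creation, bounds `σ` times the expected size of the basin of this equilibrium. -/
lemma sum_levelCard_le_of_barrier (hK : 0 < K) {j : ℕ} (hj : j ≠ 0) (σ : ℝ)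
    (W : ℕ → ℕ → ℕ → ℝ)
    (hW : ∀ u v P : ℕ, u ≤ K → v ≤ K →
      u * v * (W (u - 1) (v - 1) (P + 1) - W u v P) + u * (K - v) * (W (u - 1) v P - W u v P) +
        v * (K - u) * (W u (v - 1) P - W u v P) ≤ 0)
    (hWj : ∀ u v : ℕ, u ≤ K → v ≤ K → σ * (colGain K u v + rowGain K u v) ≤ W u v j)
    (hW0 : ∀ P < j, 0 ≤ W 0 0 P) :
    σ * ∑ Ψ : (Fin K × Fin K) ≃ Fin (K ^ 2), (levelCard (labels Ψ (K ^ 2)).col j : ℝ) ≤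
      Fintype.card ((Fin K × Fin K) ≃ Fin (K ^ 2)) * W K K 0 := by
  set Θ : ℕ → ℕ → ℕ → ℕ → ℕ → ℝ := fun u v P c r =>
    if P < j then W u v P else σ * (colGain K u v * c + rowGain K u v * r) with hΘ
  have hsuper : ∀ s : LabelState K, s.Valid → ∑ p, ((s.step p).stat j Θ - s.stat j Θ) ≤ 0 := by
    intro s hs
    rw [sum_step_stat_sub hj Θ s rfl rfl rfl rfl]
    set u := levelCard s.row 0 with hu
    set v := levelCard s.col 0 with hv
    have huK : u ≤ K := levelCard_le _ _
    have hvK : v ≤ K := levelCard_le _ _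
    by_cases hP : s.count < j
    · have hc : levelCard s.col j = 0 :=
        levelCard_eq_zero fun b => ((hs.2 b).trans_lt hP).ne
      have hr : levelCard s.row j = 0 :=
        levelCard_eq_zero fun a => ((hs.1 a).trans_lt hP).ne
      have hlast : Θ (u - 1) (v - 1) (s.count + 1) (0 + if s.count + 1 = j then 1 else 0)
          (0 + if s.count + 1 = j then 1 else 0) ≤ W (u - 1) (v - 1) (s.count + 1) := by
        by_cases h : s.count + 1 = j
        · simp only [hΘ, h, lt_irrefl, if_false, if_true, zero_add, Nat.cast_one, mul_one]
          exact hWj _ _ (by omega) (by omega)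
        · have : s.count + 1 < j := by omega
          simp [hΘ, this]
      have h := hW u v s.count huK hvK
      have hmul := mul_le_mul_of_nonneg_left (sub_le_sub_right hlast (W u v s.count))
        (by positivity : (0 : ℝ) ≤ (u : ℝ) * v)
      rw [hc, hr]
      generalize Θ (u - 1) (v - 1) (s.count + 1) (0 + if s.count + 1 = j then 1 else 0)
          (0 + if s.count + 1 = j then 1 else 0) = T at hmul ⊢
      simp only [hΘ, hP, if_true, Nat.cast_zero]
      linarith
    · have hP1 : ¬ s.count + 1 < j := by omega
      have hP2 : s.count + 1 ≠ j := by omega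
      simp only [hΘ, hP, hP1, hP2, if_false, add_zero, Nat.cast_add, Nat.cast_one]
      have h1 := colGain_drift K u v
      have h2 := rowGain_drift (u := u) (v := v) hK
      rw [chainTerm_eq_zero hvK (by omega), mul_zero] at h1
      refine le_of_eq ?_
      linear_combination σ * levelCard s.col j * h1 + σ * levelCard s.row j * h2
  have hmain := sum_labels_le_of_superharmonic (LabelState.stat j Θ) hsuper le_rfl
  have hinit : (LabelState.start K).stat j Θ = W K K 0 := by
    simp [LabelState.stat, LabelState.start, hΘ, Nat.pos_of_ne_zero hj, levelCard]
  rw [hinit] at hmain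
  refine le_trans ?_ hmain
  rw [Finset.mul_sum]
  refine Finset.sum_le_sum fun Ψ _ => ?_
  have hrow : levelCard (labels Ψ (K ^ 2)).row 0 = 0 := levelCard_eq_zero fun a =>
    (row_labels_ne_zero_iff Ψ _ a).mpr ⟨a, (Ψ (a, a)).isLt⟩
  have hcol : levelCard (labels Ψ (K ^ 2)).col 0 = 0 := levelCard_eq_zero fun b =>
    (col_labels_ne_zero_iff Ψ _ b).mpr ⟨b, (Ψ (b, b)).isLt⟩
  have hA : colGain K 0 0 = 1 := by
    rw [colGain, Finset.sum_eq_single 0]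
    · simp [chainTerm, chainCoeff]
    · intro k _ hk
      simp [chainTerm, Nat.pos_of_ne_zero hk]
    · simp
  have hB : rowGain K 0 0 = 0 := by
    refine Finset.sum_eq_zero fun k _ => ?_
    simp [chainTerm]
  simp only [LabelState.stat, hrow, hcol, hΘ]
  by_cases hP : (labels Ψ (K ^ 2)).count < j
  · have hc : levelCard (labels Ψ (K ^ 2)).col j = 0 :=
      levelCard_eq_zero fun b => (((valid_labels Ψ _).2 b).trans_lt hP).ne
    simp [hP, hc, hW0 _ hP]
  · simp [hP, hA, hB]

/-- A quadratic superharmonic function measuring the deviation from the fluid limit in which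
the `j`-th equilibrium appears when a fraction `√y` of the rows and columns is fresh. -/
def quadDev (K j : ℕ) (y : ℝ) (u v P : ℕ) : ℝ :=
  ((u * v + (2 * K - 1) * ((P : ℝ) - j) - y * K ^ 2) ^ 2 + K ^ 2 * ((u : ℝ) - v) ^ 2 +
    3 * K ^ 2 * (u + v)) / K ^ 4

lemma quadDev_drift (K j : ℕ) (y : ℝ) {u v : ℕ} (P : ℕ) (hu : u ≤ K) (hv : v ≤ K) :
    u * v * (quadDev K j y (u - 1) (v - 1) (P + 1) - quadDev K j y u v P) +
      u * (K - v) * (quadDev K j y (u - 1) v P - quadDev K j y u v P) +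
      v * (K - u) * (quadDev K j y u (v - 1) P - quadDev K j y u v P) ≤ 0 := by
  have hkey : u * v * (quadDev K j y (u - 1) (v - 1) (P + 1) - quadDev K j y u v P) +
      u * (K - v) * (quadDev K j y (u - 1) v P - quadDev K j y u v P) +
      v * (K - u) * (quadDev K j y u (v - 1) P - quadDev K j y u v P) =
      (u * v * (2 * K - u - v : ℝ) ^ 2 + u * (K - v) * (v : ℝ) ^ 2 + v * (K - u) * (u : ℝ) ^ 2 +
        K ^ 2 * (-2 * K * ((u : ℝ) - v) ^ 2 + u * (K - v) + v * (K - u)) -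
        3 * K ^ 2 * (K * (u + v))) / K ^ 4 := by
    unfold quadDev
    rcases u with _ | u <;> rcases v with _ | v <;>
      (try simp only [Nat.add_sub_cancel]) <;> push_cast <;> ring
  rw [hkey]
  refine div_nonpos_of_nonpos_of_nonneg ?_ (by positivity)
  have hu' : (u : ℝ) ≤ K := by exact_mod_cast hu
  have hv' : (v : ℝ) ≤ K := by exact_mod_cast hv
  have hu0 : (0 : ℝ) ≤ u := by positivity
  have hv0 : (0 : ℝ) ≤ v := by positivity
  have hK0 : (0 : ℝ) ≤ K := by positivity
  generalize (u : ℝ) = a at *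
  generalize (v : ℝ) = b at *
  generalize (K : ℝ) = k at *
  have h1 : a * b * (2 * k - a - b) ^ 2 ≤ a * b * (4 * k ^ 2) := by
    refine mul_le_mul_of_nonneg_left ?_ (by positivity)
    nlinarith
  have h2 : a * (k - b) * b ^ 2 ≤ a * (k - b) * k ^ 2 :=
    mul_le_mul_of_nonneg_left (by nlinarith) (mul_nonneg hu0 (by linarith))
  have h3 : b * (k - a) * a ^ 2 ≤ b * (k - a) * k ^ 2 :=
    mul_le_mul_of_nonneg_left (by nlinarith) (mul_nonneg hv0 (by linarith))
  have h4 : 0 ≤ k ^ 2 * (2 * k * (a - b) ^ 2) := by positivity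
  have h5 : 0 ≤ k ^ 2 * (a * (k - b)) := by
    have := mul_nonneg hu0 (sub_nonneg.mpr hv')
    positivity
  have h6 : 0 ≤ k ^ 2 * (b * (k - a)) := by
    have := mul_nonneg hv0 (sub_nonneg.mpr hu')
    positivity
  have h7 : 0 ≤ k ^ 2 * (a * b) := by positivity
  nlinarith

end Barrier

section FluidLimit

lemma descFactorial_eq_prod (u p : ℕ) :
    (u.descFactorial p : ℝ) = ∏ i ∈ Finset.range p, ((u : ℝ) - i) := by
  induction p with
  | zero => simp
  | succ p ih =>
    rw [Finset.prod_range_succ, ← ih, Nat.descFactorial_succ, mul_comm]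
    rcases le_or_gt p u with h | h
    · push_cast [Nat.cast_sub h]
      ring
    · simp [Nat.descFactorial_of_lt h]

lemma chainTerm_eq_prod {K : ℕ} (hK : 0 < K) (m u v : ℕ) :
    chainTerm K m u v =
      (∏ i ∈ Finset.range m,
        ((i + 1 : ℝ) - (((i + 1) / 2 : ℕ) : ℝ) * ((i + 2) / 2 : ℕ) / K)⁻¹) *
      (∏ i ∈ Finset.range (m / 2), ((u : ℝ) / K - i / K)) *
      ∏ i ∈ Finset.range ((m + 1) / 2), ((v : ℝ) / K - i / K) := by
  have hK' : (K : ℝ) ≠ 0 := by positivity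
  have h1 : chainCoeff K m = (∏ i ∈ Finset.range m,
      ((i + 1 : ℝ) - (((i + 1) / 2 : ℕ) : ℝ) * ((i + 2) / 2 : ℕ) / K)⁻¹) * ((K : ℝ) ^ m)⁻¹ := by
    rw [chainCoeff, ← inv_pow]
    have : (((K : ℝ)⁻¹) ^ m) = ∏ _i ∈ Finset.range m, (K : ℝ)⁻¹ := by simp
    rw [this, ← Finset.prod_mul_distrib]
    refine Finset.prod_congr rfl fun i _ => ?_
    rw [← mul_inv, sub_mul, div_mul_cancel₀ _ hK']
  have h2 : ∀ w p : ℕ, ∏ i ∈ Finset.range p, ((w : ℝ) / K - i / K) =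
      w.descFactorial p * ((K : ℝ) ^ p)⁻¹ := by
    intro w p
    rw [descFactorial_eq_prod, ← div_eq_mul_inv]
    simp only [← sub_div, Finset.prod_div_distrib]
    simp
  have hm : (K : ℝ) ^ m = K ^ (m / 2) * K ^ ((m + 1) / 2) := by
    rw [← pow_add]
    congr 1
    omega
  rw [chainTerm, h1, h2, h2, hm, mul_inv]
  ring

lemma tendsto_chainTerm {l : Filter (ℕ × ℕ × ℕ)} {x : ℝ}
    (hK : Filter.Tendsto (fun q => q.1) l Filter.atTop)
    (hu : Filter.Tendsto (fun q => (q.2.1 : ℝ) / q.1) l (nhds x))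
    (hv : Filter.Tendsto (fun q => (q.2.2 : ℝ) / q.1) l (nhds x)) (m : ℕ) :
    Filter.Tendsto (fun q => chainTerm q.1 m q.2.1 q.2.2) l (nhds (x ^ m / m.factorial)) := by
  have hdiv : ∀ c : ℝ, Filter.Tendsto (fun q : ℕ × ℕ × ℕ => c / (q.1 : ℝ)) l (nhds 0) :=
    fun c => (tendsto_const_div_atTop_nhds_zero_nat c).comp hK
  have h1 : Filter.Tendsto (fun q : ℕ × ℕ × ℕ => ∏ i ∈ Finset.range m,
      ((i + 1 : ℝ) - (((i + 1) / 2 : ℕ) : ℝ) * ((i + 2) / 2 : ℕ) / (q.1 : ℝ))⁻¹) l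
      (nhds (∏ i ∈ Finset.range m, ((i + 1 : ℝ) - 0)⁻¹)) := by
    refine tendsto_finsetProd _ fun i _ => ?_
    refine Filter.Tendsto.inv₀ (tendsto_const_nhds.sub (hdiv _)) ?_
    rw [sub_zero]
    positivity
  have h2 : ∀ (f : ℕ × ℕ × ℕ → ℝ), Filter.Tendsto f l (nhds x) → ∀ p : ℕ,
      Filter.Tendsto (fun q => ∏ i ∈ Finset.range p, (f q - i / (q.1 : ℝ))) l
        (nhds (∏ _i ∈ Finset.range p, (x - 0))) := fun f hf p =>
    tendsto_finsetProd _ fun i _ => hf.sub (hdiv _)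
  have h := (h1.mul (h2 _ hu (m / 2))).mul (h2 _ hv ((m + 1) / 2))
  have hlim : (∏ i ∈ Finset.range m, ((i + 1 : ℝ) - 0)⁻¹) *
      (∏ _i ∈ Finset.range (m / 2), (x - 0)) * ∏ _i ∈ Finset.range ((m + 1) / 2), (x - 0) =
      x ^ m / m.factorial := by
    simp only [sub_zero, Finset.prod_const, Finset.card_range, Finset.prod_inv_distrib]
    rw [mul_assoc, ← pow_add, ← Finset.prod_range_add_one_eq_factorial]
    push_cast
    rw [show m / 2 + (m + 1) / 2 = m by omega]
    ring
  rw [hlim] at h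
  refine h.congr' ?_
  filter_upwards [hK.eventually (Filter.eventually_gt_atTop 0)] with q hq
  exact (chainTerm_eq_prod hq m q.2.1 q.2.2).symm

lemma abs_chainTerm_le {K u v : ℕ} (hK : 0 < K) (hu : u ≤ K) (hv : v ≤ K) (m : ℕ) :
    |chainTerm K m u v| ≤ 2 ^ m / m.factorial := by
  rcases lt_or_ge (2 * K) m with hm | hm
  · rw [chainTerm_eq_zero hv hm, abs_zero]
    positivity
  have hKr : (0 : ℝ) < K := by exact_mod_cast hK
  have hcoeff : |chainCoeff K m| ≤ 2 ^ m / m.factorial * ((K : ℝ) ^ m)⁻¹ := by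
    rw [← Finset.prod_range_add_one_eq_factorial, chainCoeff, Finset.abs_prod]
    push_cast
    have hprod : (2 : ℝ) ^ m / (∏ i ∈ Finset.range m, ((i : ℝ) + 1)) * ((K : ℝ) ^ m)⁻¹ =
        ∏ i ∈ Finset.range m, (2 / ((i + 1 : ℝ) * K)) := by
      rw [Finset.prod_div_distrib, Finset.prod_mul_distrib]
      simp only [Finset.prod_const, Finset.card_range]
      rw [div_mul_eq_div_div, ← div_eq_mul_inv]
    rw [hprod]
    refine Finset.prod_le_prod (fun _ _ => abs_nonneg _) fun i hi => ?_
    have hi' : i + 1 ≤ 2 * K := by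
      have := Finset.mem_range.mp hi
      omega
    have hi'' : (i + 1 : ℝ) ≤ 2 * K := by exact_mod_cast hi'
    have hfl : 4 * ((((i + 1) / 2 : ℕ) : ℝ) * ((i + 2) / 2 : ℕ)) ≤ (i + 1 : ℝ) ^ 2 := by
      have hsum : (((i + 1) / 2 : ℕ) : ℝ) + ((i + 2) / 2 : ℕ) = i + 1 := by
        have : (i + 1) / 2 + (i + 2) / 2 = i + 1 := by omega
        exact_mod_cast this
      rw [← hsum]
      nlinarith [sq_nonneg ((((i + 1) / 2 : ℕ) : ℝ) - ((i + 2) / 2 : ℕ))]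
    have hlow : (i + 1 : ℝ) * K / 2 ≤
        (i + 1 : ℝ) * K - (((i + 1) / 2 : ℕ) : ℝ) * ((i + 2) / 2 : ℕ) := by
      nlinarith
    have hpos : (0 : ℝ) < (i + 1 : ℝ) * K / 2 := by positivity
    rw [abs_inv, abs_of_pos (hpos.trans_le hlow)]
    calc _ ≤ ((i + 1 : ℝ) * K / 2)⁻¹ := inv_anti₀ hpos hlow
      _ = _ := by rw [inv_div]
  have hdesc : ∀ {w : ℕ}, w ≤ K → ∀ p : ℕ, (w.descFactorial p : ℝ) ≤ (K : ℝ) ^ p := by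
    intro w hw p
    exact_mod_cast (Nat.descFactorial_le_pow w p).trans (Nat.pow_le_pow_left hw p)
  have hm' : (K : ℝ) ^ m = K ^ (m / 2) * K ^ ((m + 1) / 2) := by
    rw [← pow_add]
    congr 1
    omega
  rw [chainTerm, abs_mul, abs_mul, Nat.abs_cast, Nat.abs_cast]
  calc _ ≤ 2 ^ m / m.factorial * ((K : ℝ) ^ m)⁻¹ * (K : ℝ) ^ (m / 2) * (K : ℝ) ^ ((m + 1) / 2) := by
        gcongr
        · exact hdesc hu _
        · exact hdesc hv _
    _ = 2 ^ m / m.factorial := by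
        rw [mul_assoc, ← hm']
        field_simp

lemma colGain_add_rowGain_eq_tsum {K u v : ℕ} (hv : v ≤ K) :
    colGain K u v + rowGain K u v = ∑' m, chainTerm K m u v := by
  rw [tsum_eq_sum (s := Finset.range (2 * (K + 1)))]
  · unfold colGain rowGain
    generalize K + 1 = n
    induction n with
    | zero => simp
    | succ n ih =>
      rw [Finset.sum_range_succ, Finset.sum_range_succ, show 2 * (n + 1) = 2 * n + 1 + 1 by ring,
        Finset.sum_range_succ, Finset.sum_range_succ, ← ih]
      ring
  · intro m hm
    refine chainTerm_eq_zero hv ?_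
    simp only [Finset.mem_range, not_lt] at hm
    omega

lemma summable_two_pow_div_factorial : Summable fun m : ℕ => (2 : ℝ) ^ m / m.factorial :=
  Real.summable_pow_div_factorial 2

lemma abs_gain_le {K u v : ℕ} (hK : 0 < K) (hu : u ≤ K) (hv : v ≤ K) :
    |colGain K u v + rowGain K u v| ≤ ∑' m : ℕ, (2 : ℝ) ^ m / m.factorial := by
  rw [colGain_add_rowGain_eq_tsum hv, ← Real.norm_eq_abs]
  exact tsum_of_norm_bounded summable_two_pow_div_factorial.hasSum fun m =>
    abs_chainTerm_le hK hu hv m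

/-- When all the rows and columns that are fresh form a fraction close to `x`, the expected gain
of a new equilibrium is close to `exp x`. -/
lemma exists_gain_near (x : ℝ) {δ : ℝ} (hδ : 0 < δ) :
    ∃ ρ > 0, ∀ᶠ K : ℕ in Filter.atTop, ∀ u v : ℕ, u ≤ K → v ≤ K →
      |(u : ℝ) / K - x| < ρ → |(v : ℝ) / K - x| < ρ →
        |colGain K u v + rowGain K u v - Real.exp x| < δ := by
  set φ : ℕ × ℕ × ℕ → ℕ × ℝ × ℝ := fun q => (q.1, (q.2.1 : ℝ) / q.1, (q.2.2 : ℝ) / q.1) with hφ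
  set S : Set (ℕ × ℕ × ℕ) := {q | q.2.1 ≤ q.1 ∧ q.2.2 ≤ q.1} with hS
  set l := Filter.comap φ (Filter.atTop ×ˢ nhds (x, x)) ⊓ Filter.principal S with hl
  have hbase : Filter.Tendsto φ l (Filter.atTop ×ˢ nhds (x, x)) :=
    Filter.tendsto_comap.mono_left inf_le_left
  have hK : Filter.Tendsto (fun q : ℕ × ℕ × ℕ => q.1) l Filter.atTop :=
    hbase.fst
  have hxx : Filter.Tendsto (fun q => (φ q).2) l (nhds (x, x)) := hbase.snd
  have hu : Filter.Tendsto (fun q : ℕ × ℕ × ℕ => (q.2.1 : ℝ) / q.1) l (nhds x) :=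
    (continuous_fst.tendsto (x, x)).comp hxx
  have hv : Filter.Tendsto (fun q : ℕ × ℕ × ℕ => (q.2.2 : ℝ) / q.1) l (nhds x) :=
    (continuous_snd.tendsto (x, x)).comp hxx
  have hmem : ∀ᶠ q in l, q ∈ S := Filter.mem_inf_of_right (Filter.mem_principal_self S)
  have hsum : Filter.Tendsto (fun q => ∑' m, chainTerm q.1 m q.2.1 q.2.2) l
      (nhds (∑' m : ℕ, x ^ m / m.factorial)) := by
    refine tendsto_tsum_of_dominated_convergence summable_two_pow_div_factorial
      (fun m => tendsto_chainTerm hK hu hv m) ?_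
    filter_upwards [hK.eventually (Filter.eventually_gt_atTop 0), hmem] with q hq hqS m
    exact abs_chainTerm_le hq hqS.1 hqS.2 m
  have hexp : ∑' m : ℕ, x ^ m / m.factorial = Real.exp x := by
    rw [Real.exp_eq_exp_ℝ, NormedSpace.exp_eq_tsum_div]
  rw [hexp] at hsum
  have hev := hsum.eventually (Metric.ball_mem_nhds _ hδ)
  rw [hl, Filter.eventually_inf_principal, Filter.eventually_comap,
    Filter.eventually_prod_iff] at hev
  obtain ⟨p₁, hp₁, p₂, hp₂, h⟩ := hev
  obtain ⟨ρ, hρ, hball⟩ := Metric.eventually_nhds_iff.mp hp₂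
  refine ⟨ρ, hρ, ?_⟩
  filter_upwards [hp₁] with K hKp u v huK hvK hux hvx
  have hd : dist ((u : ℝ) / K, (v : ℝ) / K) (x, x) < ρ := by
    rw [Prod.dist_eq, max_lt_iff]
    exact ⟨hux, hvx⟩
  have := h hKp (hball hd) (K, u, v) rfl ⟨huK, hvK⟩
  rw [colGain_add_rowGain_eq_tsum hvK]
  exact this

/-- A quadratic bound for the deviation of the expected gain of a new equilibrium. -/
lemma exists_abs_gain_sub_exp_le {x : ℝ} (hx : 0 ≤ x) {δ : ℝ} (hδ : 0 < δ) :
    ∃ C : ℝ, 0 ≤ C ∧ ∀ᶠ K : ℕ in Filter.atTop, ∀ u v : ℕ, u ≤ K → v ≤ K →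
      |colGain K u v + rowGain K u v - Real.exp x| ≤
        δ + C * (((u : ℝ) * v / K ^ 2 - x ^ 2) ^ 2 + (((u : ℝ) - v) / K) ^ 2) := by
  obtain ⟨ρ, hρ, hev⟩ := exists_gain_near x hδ
  set M : ℝ := (∑' m : ℕ, (2 : ℝ) ^ m / m.factorial) + Real.exp x with hM
  have hM0 : 0 ≤ M := add_nonneg (tsum_nonneg fun m => by positivity) (Real.exp_pos x).le
  set s : ℝ := ρ / 2 with hs
  have hs0 : 0 < s := by positivity
  set κ : ℝ := min (s ^ 4) (s ^ 2) with hκ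
  have hκ0 : 0 < κ := lt_min (by positivity) (by positivity)
  refine ⟨M / κ, by positivity, ?_⟩
  filter_upwards [hev, Filter.eventually_gt_atTop 0] with K hK hK0 u v hu hv
  set e : ℝ := ((u : ℝ) * v / K ^ 2 - x ^ 2) ^ 2 + (((u : ℝ) - v) / K) ^ 2 with he
  have he0 : 0 ≤ e := by positivity
  rcases lt_or_ge e κ with h | h
  · have hKr : (0 : ℝ) < K := by exact_mod_cast hK0
    set a : ℝ := (u : ℝ) / K with ha
    set b : ℝ := (v : ℝ) / K with hb
    have ha0 : 0 ≤ a := by positivity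
    have hb0 : 0 ≤ b := by positivity
    have hee : e = (a * b - x ^ 2) ^ 2 + (a - b) ^ 2 := by
      rw [he, ha, hb]
      congr 2
      · rw [div_mul_div_comm]
        ring
      · rw [sub_div]
    have h1 : |a * b - x ^ 2| < s ^ 2 := by
      refine abs_lt_of_sq_lt_sq ?_ (by positivity)
      have : κ ≤ s ^ 4 := min_le_left _ _
      nlinarith [sq_nonneg (a - b)]
    have h2 : |a - b| < s := by
      refine abs_lt_of_sq_lt_sq ?_ hs0.le
      have : κ ≤ s ^ 2 := min_le_right _ _
      nlinarith [sq_nonneg (a * b - x ^ 2)]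
    have h3 : |(a + b) / 2 - x| < 3 / 2 * s := by
      refine abs_lt_of_sq_lt_sq ?_ (by positivity)
      rw [abs_lt] at h1 h2
      have hab : (a - b) ^ 2 < s ^ 2 := by nlinarith
      rcases le_or_gt x ((a + b) / 2) with hz | hz <;> nlinarith
    have hclose : |a - x| < ρ ∧ |b - x| < ρ := by
      rw [abs_lt] at h2 h3
      constructor <;> rw [abs_lt] <;> constructor <;> linarith [h2.1, h2.2, h3.1, h3.2]
    have := hK u v hu hv hclose.1 hclose.2
    have : 0 ≤ M / κ * e := by positivity
    linarith
  · have h1 : |colGain K u v + rowGain K u v - Real.exp x| ≤ M := by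
      refine (abs_sub _ _).trans ?_
      rw [abs_of_pos (Real.exp_pos x), hM]
      linarith [abs_gain_le hK0 hu hv]
    have h2 : M ≤ M / κ * e := by
      rw [div_mul_eq_mul_div, le_div_iff₀ hκ0]
      exact mul_le_mul_of_nonneg_left h hM0
    linarith

end FluidLimit

lemma tendsto_quadDev_init {ε : ℝ} (hε : 0 ≤ ε) :
    Filter.Tendsto (fun K : ℕ => quadDev K ⌊ε * K⌋₊ (1 - 2 * ε) K K 0) Filter.atTop (nhds 0) := by
  have h1 : Filter.Tendsto (fun K : ℕ => (⌊ε * K⌋₊ : ℝ) / K) Filter.atTop (nhds ε) :=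
    (tendsto_nat_floor_mul_div_atTop hε).comp tendsto_natCast_atTop_atTop
  have h2 : Filter.Tendsto (fun K : ℕ => (1 : ℝ) / K) Filter.atTop (nhds 0) :=
    tendsto_one_div_atTop_nhds_zero_nat
  have h3 : Filter.Tendsto (fun K : ℕ => (1 - (2 - (1 : ℝ) / K) * ((⌊ε * K⌋₊ : ℝ) / K) -
      (1 - 2 * ε)) ^ 2 + 6 * ((1 : ℝ) / K)) Filter.atTop
      (nhds ((1 - (2 - 0) * ε - (1 - 2 * ε)) ^ 2 + 6 * 0)) :=
    (((tendsto_const_nhds.sub ((tendsto_const_nhds.sub h2).mul h1)).sub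
      tendsto_const_nhds).pow 2).add (h2.const_mul 6)
  have h4 : (1 - (2 - 0) * ε - (1 - 2 * ε)) ^ 2 + 6 * 0 = 0 := by ring
  rw [h4] at h3
  refine h3.congr' ?_
  filter_upwards [Filter.eventually_gt_atTop 0] with K hK
  have hK' : (K : ℝ) ≠ 0 := by positivity
  unfold quadDev
  field_simp
  push_cast
  ring

lemma le_quadDev_zero {K j P : ℕ} (hK : 0 < K) (hP : P < j) {y : ℝ} (hy : 0 ≤ y) :
    y ^ 2 ≤ quadDev K j y 0 0 P := by
  have hK' : (1 : ℝ) ≤ K := by exact_mod_cast hK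
  have hP' : (P : ℝ) ≤ j := by exact_mod_cast hP.le
  unfold quadDev
  rw [le_div_iff₀ (by positivity)]
  have h : 0 ≤ (2 * K - 1) * ((j : ℝ) - P) := mul_nonneg (by linarith) (by linarith)
  have hyK : 0 ≤ y * K ^ 2 := by positivity
  push_cast
  nlinarith

lemma le_quadDev_self {K : ℕ} (hK : 0 < K) (j u v : ℕ) (y : ℝ) :
    ((u : ℝ) * v / K ^ 2 - y) ^ 2 + (((u : ℝ) - v) / K) ^ 2 ≤ quadDev K j y u v j := by
  have hK' : (K : ℝ) ≠ 0 := by positivity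
  have h : quadDev K j y u v j = ((u : ℝ) * v / K ^ 2 - y) ^ 2 + (((u : ℝ) - v) / K) ^ 2 +
      3 * (u + v) / K ^ 2 := by
    unfold quadDev
    field_simp
    ring
  rw [h]
  have : (0 : ℝ) ≤ 3 * (u + v) / K ^ 2 := by positivity
  linarith

/-- The expected rescaled size of the basin of attraction of the `⌊εK⌋`-th best
pure Nash equilibrium of a uniformly random potential converges to
`exp(√(1-2ε))` as `K → ∞`. -/
theorem stmt6 (ε : ℝ) (hε1 : 0 < ε) (hε2 : ε < 1 / 2) :
    Filter.Tendsto (fun K : ℕ =>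
        (∑ Ψ : (Fin K × Fin K) ≃ Fin (K ^ 2),
            (basinOfRank Ψ ⌊ε * K⌋₊ : ℝ) / K) /
          (Fintype.card ((Fin K × Fin K) ≃ Fin (K ^ 2)) : ℝ))
      Filter.atTop (nhds (Real.exp (Real.sqrt (1 - 2 * ε)))) := by
  set x : ℝ := Real.sqrt (1 - 2 * ε) with hx
  have hy : 0 < 1 - 2 * ε := by linarith
  have hxsq : x ^ 2 = 1 - 2 * ε := Real.sq_sqrt hy.le
  rw [Metric.tendsto_atTop']
  intro η hη
  obtain ⟨C₀, hC₀, hgain⟩ :=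
    exists_abs_gain_sub_exp_le (Real.sqrt_nonneg (1 - 2 * ε)) (half_pos hη)
  rw [← hx] at hgain
  set C : ℝ := C₀ + Real.exp x / (1 - 2 * ε) ^ 2 with hC
  have hCC₀ : C₀ ≤ C := le_add_of_nonneg_right (by positivity)
  have hC0 : 0 ≤ C := hC₀.trans hCC₀
  have hinit := (tendsto_quadDev_init hε1.le).const_mul C
  rw [mul_zero] at hinit
  have hfloor : Filter.Tendsto (fun K : ℕ => ⌊ε * K⌋₊) Filter.atTop Filter.atTop :=
    tendsto_nat_floor_atTop.comp (tendsto_natCast_atTop_atTop.const_mul_atTop hε1)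
  have hev : ∀ᶠ K : ℕ in Filter.atTop,
      dist ((∑ Ψ : (Fin K × Fin K) ≃ Fin (K ^ 2), (basinOfRank Ψ ⌊ε * K⌋₊ : ℝ) / K) /
        (Fintype.card ((Fin K × Fin K) ≃ Fin (K ^ 2)) : ℝ)) (Real.exp x) < η := by
    filter_upwards [hgain, hinit.eventually (gt_mem_nhds (half_pos hη)),
      hfloor.eventually (Filter.eventually_ne_atTop 0), Filter.eventually_gt_atTop 0]
      with K hgainK hinitK hj hK
    set j := ⌊ε * K⌋₊ with hjdef
    have hKr : (K : ℝ) ≠ 0 := by positivity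
    have hcard : 0 < (Fintype.card ((Fin K × Fin K) ≃ Fin (K ^ 2)) : ℝ) := by
      have : Nonempty ((Fin K × Fin K) ≃ Fin (K ^ 2)) :=
        ⟨Fintype.equivOfCardEq (by simp [sq])⟩
      exact_mod_cast Fintype.card_pos
    have hbasin : ∀ Ψ : (Fin K × Fin K) ≃ Fin (K ^ 2),
        (basinOfRank Ψ j : ℝ) / K = levelCard (labels Ψ (K ^ 2)).col j := by
      intro Ψ
      rw [basinOfRank_eq, Nat.cast_mul, mul_div_cancel_left₀ _ hKr, levelCard]
    simp only [hbasin]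
    have hgain' : ∀ u v : ℕ, u ≤ K → v ≤ K →
        |colGain K u v + rowGain K u v - Real.exp x| ≤
          η / 2 + C * quadDev K j (1 - 2 * ε) u v j := by
      intro u v hu hv
      refine (hgainK u v hu hv).trans ?_
      rw [hxsq]
      have := le_quadDev_self hK j u v (1 - 2 * ε)
      gcongr
    have hbarrier : ∀ c : ℝ, ∀ u v P : ℕ, u ≤ K → v ≤ K →
        u * v * ((c + C * quadDev K j (1 - 2 * ε) (u - 1) (v - 1) (P + 1)) -
            (c + C * quadDev K j (1 - 2 * ε) u v P)) +
          u * (K - v) * ((c + C * quadDev K j (1 - 2 * ε) (u - 1) v P) -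
            (c + C * quadDev K j (1 - 2 * ε) u v P)) +
          v * (K - u) * ((c + C * quadDev K j (1 - 2 * ε) u (v - 1) P) -
            (c + C * quadDev K j (1 - 2 * ε) u v P)) ≤ 0 := by
      intro c u v P hu hv
      have := mul_nonpos_of_nonneg_of_nonpos hC0 (quadDev_drift K j (1 - 2 * ε) P hu hv)
      linarith
    have hzero : ∀ P < j, Real.exp x ≤ C * quadDev K j (1 - 2 * ε) 0 0 P := by
      intro P hP
      calc Real.exp x = Real.exp x / (1 - 2 * ε) ^ 2 * (1 - 2 * ε) ^ 2 := by field_simp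
        _ ≤ C * quadDev K j (1 - 2 * ε) 0 0 P :=
          mul_le_mul (le_add_of_nonneg_left hC₀) (le_quadDev_zero hK hP hy.le) (by positivity) hC0
    have hupper := sum_levelCard_le_of_barrier hK hj 1
      (fun u v P => (Real.exp x + η / 2) + C * quadDev K j (1 - 2 * ε) u v P)
      (hbarrier _)
      (fun u v hu hv => by linarith [(abs_le.mp (hgain' u v hu hv)).2])
      (fun P hP => by linarith [hzero P hP, Real.exp_pos x])
    have hlower := sum_levelCard_le_of_barrier hK hj (-1)
      (fun u v P => (-Real.exp x + η / 2) + C * quadDev K j (1 - 2 * ε) u v P)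
      (hbarrier _)
      (fun u v hu hv => by linarith [(abs_le.mp (hgain' u v hu hv)).1])
      (fun P hP => by linarith [hzero P hP])
    rw [Real.dist_eq, abs_lt, lt_sub_iff_add_lt, sub_lt_iff_lt_add, lt_div_iff₀ hcard,
      div_lt_iff₀ hcard]
    constructor
    · have := mul_lt_mul_of_pos_left hinitK hcard
      nlinarith
    · have := mul_lt_mul_of_pos_left hinitK hcard
      nlinarith
  obtain ⟨N, hN⟩ := Filter.eventually_atTop.mp hev
  exact ⟨N, fun K hK => hN K hK.le⟩
end
end
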